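/- Every set of at least 10 points in the plane in general position contains a 3-crossing family, i.e., three segments spanned by the points that pairwise cross in their interiors. -/

import Mathlib

/-- A finite set of points in the plane is in *general position* if no three of
its points are collinear. -/
def GenPos (S : Finset (ℝ × ℝ)) : Prop :=
  ∀ p ∈ S, ∀ q ∈ S, ∀ r ∈ S, p ≠ q → p ≠ r → q ≠ r →
    ¬Collinear ℝ ({p, q, r} : Set (ℝ × ℝ))

/-- Two closed segments `pq` and `rs` *cross* if they intersect in exactly one
point, which lies in the interior of both segments. -/
def Crosses (p q r s : ℝ × ℝ) : Prop :=
  ∃ x : ℝ × ℝ, x ∈ openSegment ℝ p q ∧ x ∈ openSegment ℝ r s ∧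
    segment ℝ p q ∩ segment ℝ r s = {x}

/-- `F` is a *crossing family* in `S`: a finite set of segments (given by their
pairs of distinct endpoints, which belong to `S`) that pairwise cross. -/
def IsCrossingFamily (S : Finset (ℝ × ℝ)) (F : Finset ((ℝ × ℝ) × (ℝ × ℝ))) : Prop :=
  (∀ e ∈ F, e.1 ∈ S ∧ e.2 ∈ S ∧ e.1 ≠ e.2) ∧
  (∀ e ∈ F, ∀ f ∈ F, e ≠ f → Crosses e.1 e.2 f.1 f.2)

/-- `S` contains a `k`-crossing family. -/
def HasCrossingFamily (S : Finset (ℝ × ℝ)) (k : ℕ) : Prop :=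
  ∃ F : Finset ((ℝ × ℝ) × (ℝ × ℝ)), IsCrossingFamily S F ∧ F.card = k

/-- `cf S`: the maximum size of a crossing family in `S`. -/
noncomputable def cf (S : Finset (ℝ × ℝ)) : ℕ :=
  sSup {k : ℕ | HasCrossingFamily S k}

/-- `cfNat n`: the minimum of `cf S` over all sets `S` of `n` points in
general position. -/
noncomputable def cfNat (n : ℕ) : ℕ :=
  sInf {m : ℕ | ∃ S : Finset (ℝ × ℝ), S.card = n ∧ GenPos S ∧ cf S = m}

/-- Twice the signed area of the triangle `pqr`; it is positive when `pqr` turns left. -/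
def orient (p q r : ℝ × ℝ) : ℝ :=
  (q.1 - p.1) * (r.2 - p.2) - (q.2 - p.2) * (r.1 - p.1)

/-! ### Geometry of crossing segments -/

lemma collinear_of_orient_eq_zero {p q r : ℝ × ℝ} (hpq : p ≠ q) (h : orient p q r = 0) :
    Collinear ℝ ({p, q, r} : Set (ℝ × ℝ)) := by
  rw [collinear_iff_of_mem (p₀ := p) (by simp)]
  refine ⟨q - p, ?_⟩
  simp only [Set.mem_insert_iff, Set.mem_singleton_iff, vadd_eq_add]
  unfold orient at h
  rintro z (rfl | rfl | rfl)
  · exact ⟨0, by simp⟩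
  · exact ⟨1, by simp⟩
  · by_cases hx : q.1 - p.1 = 0
    · have hy : q.2 - p.2 ≠ 0 := fun hy => hpq (Prod.ext (by linarith) (by linarith))
      refine ⟨(z.2 - p.2) / (q.2 - p.2), Prod.ext ?_ ?_⟩
      · have : (q.2 - p.2) * (z.1 - p.1) = 0 := by linear_combination (z.2 - p.2) * hx - h
        have := (mul_eq_zero.1 this).resolve_left hy
        simp only [Prod.fst_add, Prod.smul_fst, Prod.fst_sub, hx, smul_eq_mul]
        linarith
      · simp only [Prod.snd_add, Prod.smul_snd, Prod.snd_sub, smul_eq_mul]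
        field_simp
        ring
    · refine ⟨(z.1 - p.1) / (q.1 - p.1), Prod.ext ?_ ?_⟩
      · simp only [Prod.fst_add, Prod.smul_fst, Prod.fst_sub, smul_eq_mul]
        field_simp
        ring
      · simp only [Prod.snd_add, Prod.smul_snd, Prod.snd_sub, smul_eq_mul]
        field_simp
        linear_combination h

lemma Crosses.symm {p q r s : ℝ × ℝ} (h : Crosses p q r s) : Crosses r s p q := by
  obtain ⟨x, hpq, hrs, h⟩ := h
  exact ⟨x, hrs, hpq, by rw [Set.inter_comm, h]⟩

/-- If `r, s` lie on different sides of the line `pq`, the line `pq` meets the segment `rs` only in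
the point dividing it in the ratio of the distances to the line. -/
lemma eq_of_mem_segment_of_mem_segment {p q r s z : ℝ × ℝ} (h : orient p q r ≠ orient p q s)
    (hz : z ∈ segment ℝ p q) (hz' : z ∈ segment ℝ r s) :
    z = (-orient p q s / (orient p q r - orient p q s)) • r +
      (orient p q r / (orient p q r - orient p q s)) • s := by
  obtain ⟨a, b, -, -, hab, rfl⟩ := hz
  obtain ⟨c, d, -, -, hcd, hz⟩ := hz'
  have h₁ := congrArg Prod.fst hz
  have h₂ := congrArg Prod.snd hz
  simp only [Prod.fst_add, Prod.smul_fst, Prod.snd_add, Prod.smul_snd, smul_eq_mul] at h₁ h₂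
  have hb : b = 1 - a := by linarith
  have hd : d = 1 - c := by linarith
  subst hb hd
  have hne : orient p q r - orient p q s ≠ 0 := sub_ne_zero.2 h
  have key : c * orient p q r + (1 - c) * orient p q s = 0 := by
    unfold orient
    linear_combination (q.1 - p.1) * h₂ - (q.2 - p.2) * h₁
  have hc : c = -orient p q s / (orient p q r - orient p q s) := by
    rw [eq_div_iff hne]; linarith
  have hd : 1 - c = orient p q r / (orient p q r - orient p q s) := by
    rw [eq_div_iff hne]; linarith
  rw [← hc, ← hd, hz]

lemma crosses_of_orient {p q r s : ℝ × ℝ}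
    (h₁ : orient p q r * orient p q s < 0) (h₂ : orient r s p * orient r s q < 0) :
    Crosses p q r s := by
  have split : ∀ {u v : ℝ}, u * v < 0 → u ≠ v ∧ 0 < -v / (u - v) ∧ 0 < u / (u - v) ∧
      -v / (u - v) + u / (u - v) = 1 := by
    intro u v h
    have hne : u ≠ v := by rintro rfl; nlinarith [mul_self_nonneg u]
    have hsub : u - v ≠ 0 := sub_ne_zero.2 hne
    refine ⟨hne, ?_, ?_, by field_simp; ring⟩
    · rcases mul_neg_iff.1 h with ⟨hu, hv⟩ | ⟨hu, hv⟩
      · exact div_pos (by linarith) (by linarith)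
      · exact div_pos_of_neg_of_neg (by linarith) (by linarith)
    · rcases mul_neg_iff.1 h with ⟨hu, hv⟩ | ⟨hu, hv⟩
      · exact div_pos (by linarith) (by linarith)
      · exact div_pos_of_neg_of_neg (by linarith) (by linarith)
  obtain ⟨hne, hc, hd, hcd⟩ := split h₁
  obtain ⟨hne', ha, hb, hab⟩ := split h₂
  set x := (-orient p q s / (orient p q r - orient p q s)) • r +
    (orient p q r / (orient p q r - orient p q s)) • s with hx
  have hxy : x = (-orient r s q / (orient r s p - orient r s q)) • p +
      (orient r s p / (orient r s p - orient r s q)) • q := by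
    have hsub := sub_ne_zero.2 hne
    have hsub' := sub_ne_zero.2 hne'
    have hden : orient r s p - orient r s q = -(orient p q r - orient p q s) := by
      unfold orient; ring
    rw [hx, hden]
    refine Prod.ext ?_ ?_ <;>
      simp only [Prod.fst_add, Prod.smul_fst, Prod.snd_add, Prod.smul_snd, smul_eq_mul] <;>
      field_simp <;> unfold orient <;> ring
  have hrs : x ∈ openSegment ℝ r s := ⟨_, _, hc, hd, hcd, rfl⟩
  have hpq : x ∈ openSegment ℝ p q := hxy ▸ ⟨_, _, ha, hb, hab, rfl⟩
  refine ⟨x, hpq, hrs, Set.eq_singleton_iff_unique_mem.2 ⟨?_, ?_⟩⟩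
  · exact ⟨openSegment_subset_segment ℝ p q hpq, openSegment_subset_segment ℝ r s hrs⟩
  · rintro z ⟨hz, hw⟩
    exact eq_of_mem_segment_of_mem_segment hne hz hw

/-! ### Sorting ten points around an extreme point -/

/-- Comparing `y / (x + |y|)` compares directions in the right half-plane. -/
lemma cross_nonneg_of_div_le_div {x y x' y' : ℝ} (hx : 0 ≤ x) (hy : x = 0 → 0 < y)
    (hx' : 0 ≤ x') (hy' : x' = 0 → 0 < y') (h : y / (x + |y|) ≤ y' / (x' + |y'|)) :
    0 ≤ x * y' - y * x' := by
  have pos : ∀ {x y : ℝ}, 0 ≤ x → (x = 0 → 0 < y) → 0 < x + |y| := by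
    intro x y hx hy
    rcases hx.eq_or_lt with h | h
    · have := abs_pos.2 (hy h.symm).ne'
      linarith
    · have := abs_nonneg y
      linarith
  rw [div_le_div_iff₀ (pos hx hy) (pos hx' hy')] at h
  rcases abs_cases y with ⟨e, hs⟩ | ⟨e, hs⟩ <;> rcases abs_cases y' with ⟨e', hs'⟩ | ⟨e', hs'⟩ <;>
    rw [e, e'] at h <;> nlinarith

/-- Ten points in general position sorted counterclockwise around the extreme point `q 0`. -/
structure IsSorted (q : ℕ → ℝ × ℝ) : Prop where
  orient_zero : ∀ {b c}, 0 < b → b < c → c < 10 → 0 < orient (q 0) (q b) (q c)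
  orient_ne : ∀ {a b c}, a < b → b < c → c < 10 → orient (q a) (q b) (q c) ≠ 0
  ne : ∀ {a b}, a < b → b < 10 → q a ≠ q b

lemma exists_isSorted {S : Finset (ℝ × ℝ)} (hcard : 10 ≤ S.card) (hgp : GenPos S) :
    ∃ q : ℕ → ℝ × ℝ, (∀ i < 10, q i ∈ S) ∧ IsSorted q := by
  have hne : S.Nonempty := Finset.card_pos.1 (by omega)
  obtain ⟨p, hp, hmin⟩ := S.exists_min_image (fun z => toLex z) hne
  have half : ∀ z ∈ S.erase p, 0 ≤ z.1 - p.1 ∧ (z.1 - p.1 = 0 → 0 < z.2 - p.2) := by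
    intro z hz
    obtain ⟨hzp, hz⟩ := Finset.mem_erase.1 hz
    rcases Prod.Lex.toLex_le_toLex.1 (hmin z hz) with h | ⟨h, h'⟩
    · exact ⟨by linarith, fun h₀ => by linarith⟩
    · refine ⟨by linarith, fun _ => sub_pos.2 (lt_of_le_of_ne h' fun h'' => hzp ?_)⟩
      exact Prod.ext h.symm h''.symm
  let key : ℝ × ℝ → ℝ := fun z => (z.2 - p.2) / (z.1 - p.1 + |z.2 - p.2|)
  have orient_ne : ∀ x ∈ S, ∀ y ∈ S, ∀ z ∈ S, x ≠ y → x ≠ z → y ≠ z → orient x y z ≠ 0 :=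
    fun x hx y hy z hz hxy hxz hyz h =>
      hgp x hx y hy z hz hxy hxz hyz (collinear_of_orient_eq_zero hxy h)
  have key_le : ∀ y ∈ S.erase p, ∀ z ∈ S.erase p, key y ≤ key z → 0 ≤ orient p y z :=
    fun y hy z hz h => cross_nonneg_of_div_le_div (half y hy).1 (half y hy).2
      (half z hz).1 (half z hz).2 h
  have key_inj : Set.InjOn key (S.erase p) := by
    intro y hy z hz h
    by_contra hyz
    have h₁ := key_le y hy z hz h.le
    have h₂ := key_le z hz y hy h.ge
    refine orient_ne p hp y (Finset.mem_of_mem_erase hy) z (Finset.mem_of_mem_erase hz)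
      (Finset.ne_of_mem_erase hy).symm (Finset.ne_of_mem_erase hz).symm hyz ?_
    unfold orient at *
    linarith
  have hcard' : 9 ≤ ((S.erase p).image key).card := by
    rw [Finset.card_image_of_injOn key_inj, Finset.card_erase_of_mem hp]
    omega
  let e := Finset.orderEmbOfCardLe _ hcard'
  have hpre : ∀ i, ∃ z ∈ S.erase p, key z = e i := fun i =>
    Finset.mem_image.1 (Finset.orderEmbOfCardLe_mem _ hcard' i)
  choose g hg hkey using hpre
  let q : ℕ → ℝ × ℝ := fun n => if h : n - 1 < 9 ∧ 0 < n then g ⟨n - 1, h.1⟩ else p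
  have hq₀ : q 0 = p := by simp [q]
  have hq : ∀ n, 0 < n → n < 10 → ∃ i : Fin 9, (i : ℕ) + 1 = n ∧ q n = g i := fun n h₀ h =>
    ⟨⟨n - 1, by omega⟩, by simp only; omega, dif_pos (⟨by omega, h₀⟩ : n - 1 < 9 ∧ 0 < n)⟩
  have hmem : ∀ i < 10, q i ∈ S := by
    intro n hn
    rcases n.eq_zero_or_pos with rfl | h₀
    · rwa [hq₀]
    · obtain ⟨i, -, hi⟩ := hq n h₀ hn
      exact hi ▸ Finset.mem_of_mem_erase (hg i)
  have hlt : ∀ {b c}, b < c → c < 10 → q b ≠ q c := by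
    intro b c hbc hc
    obtain ⟨j, hj, hqj⟩ := hq c (by omega) hc
    rcases b.eq_zero_or_pos with rfl | h₀
    · rw [hq₀, hqj]
      exact (Finset.ne_of_mem_erase (hg j)).symm
    · obtain ⟨i, hi, hqi⟩ := hq b h₀ (by omega)
      rw [hqi, hqj]
      intro h
      have : i = j := e.injective (by rw [← hkey, ← hkey, h])
      omega
  have horient : ∀ {a b c}, a < b → b < c → c < 10 → orient (q a) (q b) (q c) ≠ 0 :=
    fun hab hbc hc => orient_ne _ (hmem _ (by omega)) _ (hmem _ (by omega)) _ (hmem _ hc)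
      (hlt hab (by omega)) (hlt (hab.trans hbc) hc) (hlt hbc hc)
  refine ⟨q, hmem, fun {b c} hb hbc hc => ?_, horient, hlt⟩
  refine lt_of_le_of_ne ?_ (horient hb hbc hc).symm
  obtain ⟨i, hi, hqi⟩ := hq b hb (by omega)
  obtain ⟨j, hj, hqj⟩ := hq c (by omega) hc
  rw [hq₀, hqi, hqj]
  refine key_le _ (hg i) _ (hg j) ?_
  rw [hkey, hkey]
  exact e.monotone (Fin.le_def.2 (by omega))

/-! ### Sign patterns of four sorted points -/

/-- Among the signs of `abc, abd, acd, bcd` no three in this order alternate. -/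
def Signotope (σ : ℕ → ℕ → ℕ → Prop) (a b c d : ℕ) : Prop :=
  ¬(σ a b c ∧ ¬σ a b d ∧ σ a c d) ∧ ¬(¬σ a b c ∧ σ a b d ∧ ¬σ a c d) ∧
  ¬(σ a b c ∧ ¬σ a b d ∧ σ b c d) ∧ ¬(¬σ a b c ∧ σ a b d ∧ ¬σ b c d) ∧
  ¬(σ a b c ∧ ¬σ a c d ∧ σ b c d) ∧ ¬(¬σ a b c ∧ σ a c d ∧ ¬σ b c d) ∧
  ¬(σ a b d ∧ ¬σ a c d ∧ σ b c d) ∧ ¬(¬σ a b d ∧ σ a c d ∧ ¬σ b c d)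

namespace IsSorted

variable {q : ℕ → ℝ × ℝ}

lemma not_pos_iff (hq : IsSorted q) {a b c : ℕ} (hab : a < b) (hbc : b < c) (hc : c < 10) :
    ¬0 < orient (q a) (q b) (q c) ↔ orient (q a) (q b) (q c) < 0 := by
  rw [not_lt]
  exact ⟨fun h => lt_of_le_of_ne h (hq.orient_ne hab hbc hc), le_of_lt⟩

lemma signotope (hq : IsSorted q) {a b c d : ℕ} (hab : a < b) (hbc : b < c) (hcd : c < d)
    (hd : d < 10) :
    Signotope (fun i j k => 0 < orient (q i) (q j) (q k)) a b c d := by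
  have habc := hq.not_pos_iff hab hbc (by omega)
  have habd := hq.not_pos_iff hab (hbc.trans hcd) hd
  have hacd := hq.not_pos_iff (hab.trans hbc) hcd hd
  have hbcd := hq.not_pos_iff hbc hcd hd
  unfold Signotope
  simp only [habc, habd, hacd, hbcd]
  rcases a.eq_zero_or_pos with rfl | ha
  · have h₁ := hq.orient_zero hab hbc (by omega)
    have h₂ := hq.orient_zero hab (hbc.trans hcd) hd
    have h₃ := hq.orient_zero (hab.trans hbc) hcd hd
    refine ⟨?_, ?_, ?_, ?_, ?_, ?_, ?_, ?_⟩ <;> rintro ⟨h, h', h''⟩ <;> linarith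
  have hab' := hq.orient_zero ha hab (by omega)
  have hac' := hq.orient_zero ha (hab.trans hbc) (by omega)
  have had' := hq.orient_zero ha (hab.trans (hbc.trans hcd)) hd
  have hbc' := hq.orient_zero (ha.trans hab) hbc (by omega)
  have hbd' := hq.orient_zero (ha.trans hab) (hbc.trans hcd) hd
  have hcd' := hq.orient_zero (ha.trans (hab.trans hbc)) hcd hd
  have rel_bcd : orient (q a) (q b) (q c) * orient (q 0) (q a) (q d) +
      orient (q a) (q c) (q d) * orient (q 0) (q a) (q b) =
      orient (q a) (q b) (q d) * orient (q 0) (q a) (q c) := by unfold orient; ring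
  have rel_acd : orient (q a) (q b) (q c) * orient (q 0) (q b) (q d) +
      orient (q b) (q c) (q d) * orient (q 0) (q a) (q b) =
      orient (q a) (q b) (q d) * orient (q 0) (q b) (q c) := by unfold orient; ring
  have rel_abd : orient (q a) (q b) (q c) * orient (q 0) (q c) (q d) +
      orient (q b) (q c) (q d) * orient (q 0) (q a) (q c) =
      orient (q a) (q c) (q d) * orient (q 0) (q b) (q c) := by unfold orient; ring
  have rel_abc : orient (q a) (q b) (q d) * orient (q 0) (q c) (q d) +
      orient (q b) (q c) (q d) * orient (q 0) (q a) (q d) =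
      orient (q a) (q c) (q d) * orient (q 0) (q b) (q d) := by unfold orient; ring
  have mixed : ∀ {u v w x y z : ℝ}, 0 < x → 0 < y → 0 < z → u * x + w * y = v * z →
      ¬(0 < u ∧ v < 0 ∧ 0 < w) ∧ ¬(u < 0 ∧ 0 < v ∧ w < 0) := by
    intro u v w x y z hx hy hz h
    constructor <;> rintro ⟨hu, hv, hw⟩
    · linarith [mul_pos hu hx, mul_pos hw hy, mul_neg_of_neg_of_pos hv hz]
    · linarith [mul_neg_of_neg_of_pos hu hx, mul_neg_of_neg_of_pos hw hy, mul_pos hv hz]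
  obtain ⟨h₁, h₂⟩ := mixed had' hab' hac' rel_bcd
  obtain ⟨h₃, h₄⟩ := mixed hbd' hab' hbc' rel_acd
  obtain ⟨h₅, h₆⟩ := mixed hcd' hac' hbc' rel_abd
  obtain ⟨h₇, h₈⟩ := mixed hcd' had' hbd' rel_abc
  exact ⟨h₁, h₂, h₃, h₄, h₅, h₆, h₇, h₈⟩

/-- The four sorted points are in convex position in the order `abcd`. -/
lemma crosses_of_iff (hq : IsSorted q) {a b c d : ℕ} (hab : a < b) (hbc : b < c) (hcd : c < d)
    (hd : d < 10)
    (h : 0 < orient (q a) (q b) (q c) ↔ 0 < orient (q b) (q c) (q d)) :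
    Crosses (q a) (q c) (q b) (q d) := by
  have hs := hq.signotope hab hbc hcd hd
  have habc := hq.not_pos_iff hab hbc (by omega)
  have habd := hq.not_pos_iff hab (hbc.trans hcd) hd
  have hacd := hq.not_pos_iff (hab.trans hbc) hcd hd
  have hbcd := hq.not_pos_iff hbc hcd hd
  have e₁ : orient (q a) (q c) (q b) = -orient (q a) (q b) (q c) := by unfold orient; ring
  have e₂ : orient (q b) (q d) (q a) = orient (q a) (q b) (q d) := by unfold orient; ring
  have e₃ : orient (q b) (q d) (q c) = -orient (q b) (q c) (q d) := by unfold orient; ring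
  unfold Signotope at hs
  refine crosses_of_orient ?_ ?_
  · rw [e₁, neg_mul, neg_lt_zero, mul_pos_iff]
    grind
  · rw [e₂, e₃, mul_neg, neg_lt_zero, mul_pos_iff]
    grind

/-- The four sorted points are in convex position in the order `abdc`. -/
lemma crosses_of_not_iff (hq : IsSorted q) {a b c d : ℕ} (hab : a < b) (hbc : b < c) (hcd : c < d)
    (hd : d < 10)
    (h : ¬(0 < orient (q a) (q b) (q d) ↔ 0 < orient (q a) (q c) (q d))) :
    Crosses (q a) (q d) (q b) (q c) := by
  have hs := hq.signotope hab hbc hcd hd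
  have habc := hq.not_pos_iff hab hbc (by omega)
  have habd := hq.not_pos_iff hab (hbc.trans hcd) hd
  have hacd := hq.not_pos_iff (hab.trans hbc) hcd hd
  have hbcd := hq.not_pos_iff hbc hcd hd
  have e₁ : orient (q a) (q d) (q b) = -orient (q a) (q b) (q d) := by unfold orient; ring
  have e₂ : orient (q a) (q d) (q c) = -orient (q a) (q c) (q d) := by unfold orient; ring
  have e₃ : orient (q b) (q c) (q a) = orient (q a) (q b) (q c) := by unfold orient; ring
  unfold Signotope at hs
  refine crosses_of_orient ?_ ?_
  · rw [e₁, e₂, neg_mul_neg, mul_neg_iff]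
    grind
  · rw [e₃, mul_neg_iff]
    grind

end IsSorted

/-! ### The case distinction on the signs -/

namespace SignCertificate

/-- `Q` records that the triple `abc` with digits `a < b < c` is positive. -/
def isPos (Q a b c : ℕ) : Bool := a == 0 || Q.testBit (100 * a + 10 * b + c)

/-- `Q` records that the triple `abc` is not positive. -/
def isNeg (Q a b c : ℕ) : Bool := Q.testBit (1000 + (100 * a + 10 * b + c))

/-- `Q` contradicts `Signotope` for `abcd`. -/
def violates (Q a b c d : ℕ) : Bool :=
  let p := isPos Q
  let n := isNeg Q
  a.blt b && b.blt c && c.blt d &&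
  (p a b c && n a b d && p a c d || n a b c && p a b d && n a c d ||
   p a b c && n a b d && p b c d || n a b c && p a b d && n b c d ||
   p a b c && n a c d && p b c d || n a b c && p a c d && n b c d ||
   p a b d && n a c d && p b c d || n a b d && p a c d && n b c d)

/-- `Q` implies that the segments `ax` and `by` cross, where `a < b < x, y`. -/
def crossing (Q a x b y : ℕ) : Bool :=
  let p := isPos Q
  let n := isNeg Q
  a.blt b && b.blt x && b.blt y &&
  (x.blt y && (p a b x && p b x y || n a b x && n b x y) ||
   y.blt x && (p a b x && n a y x || n a b x && p a y x))

/-- The sign information `Q` is refuted by the four or six points given by the digits of `n`. -/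
def refuted (Q n : ℕ) : Bool :=
  let a := n / 100000
  let b := n / 10000 % 10
  let c := n / 1000 % 10
  let x := n / 100 % 10
  let y := n / 10 % 10
  let z := n % 10
  if n < 10000 then violates Q c x y z
  else crossing Q a x b y && crossing Q a x c z && crossing Q b y c z

/-- Run through a row of a case distinction: a number with three digits distinguishes the two signs
of this triple in the current case, any other number closes the current case. The remaining cases
are passed on to `k`. -/
def runRow (k : List ℕ → Bool) : List ℕ → List ℕ → Bool
  | [], cases => k cases
  | _ :: _, [] => true
  | n :: ns, Q :: cases =>
    if n < 1000 then runRow k ns ((Q ||| 1 <<< n) :: (Q ||| 1 <<< (1000 + n)) :: cases)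
    else refuted Q n && runRow k ns cases

/-- Run through a case distinction, at the end of which no case may remain. -/
def run : List (List ℕ) → List ℕ → Bool
  | [], cases => cases.isEmpty
  | row :: rows, cases => runRow (run rows) row cases

/-- The sign information `Q` is correct for the points `q`. -/
def Holds (q : ℕ → ℝ × ℝ) (Q : ℕ) : Prop :=
  ∀ a b c, a < 10 → b < 10 → c < 10 →
    (Q.testBit (100 * a + 10 * b + c) → 0 < orient (q a) (q b) (q c)) ∧
    (Q.testBit (1000 + (100 * a + 10 * b + c)) → ¬0 < orient (q a) (q b) (q c))

variable {q : ℕ → ℝ × ℝ} {Q : ℕ}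

lemma Holds.of_isPos (h : Holds q Q) (hq : IsSorted q) {a b c : ℕ} (hab : a < b) (hbc : b < c)
    (hc : c < 10) (hp : isPos Q a b c) : 0 < orient (q a) (q b) (q c) := by
  rcases a.eq_zero_or_pos with rfl | ha
  · exact hq.orient_zero hab hbc hc
  · refine (h a b c (by omega) (by omega) hc).1 ?_
    simpa [isPos, ha.ne'] using hp

lemma Holds.of_isNeg (h : Holds q Q) {a b c : ℕ} (hab : a < b) (hbc : b < c)
    (hc : c < 10) (hn : isNeg Q a b c) : ¬0 < orient (q a) (q b) (q c) :=
  (h a b c (by omega) (by omega) hc).2 hn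

lemma Holds.violates_eq_false (h : Holds q Q) (hq : IsSorted q) {a b c d : ℕ} (hd : d < 10) :
    violates Q a b c d = false := by
  rw [Bool.eq_false_iff]
  intro hv
  simp only [violates, Bool.and_eq_true, Bool.or_eq_true, Nat.blt_eq] at hv
  obtain ⟨⟨⟨hab, hbc⟩, hcd⟩, hv⟩ := hv
  have hs := hq.signotope hab hbc hcd hd
  have p₁ := h.of_isPos hq hab hbc (by omega)
  have p₂ := h.of_isPos hq hab (hbc.trans hcd) hd
  have p₃ := h.of_isPos hq (hab.trans hbc) hcd hd
  have p₄ := h.of_isPos hq hbc hcd hd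
  have n₁ := h.of_isNeg hab hbc (by omega)
  have n₂ := h.of_isNeg hab (hbc.trans hcd) hd
  have n₃ := h.of_isNeg (hab.trans hbc) hcd hd
  have n₄ := h.of_isNeg hbc hcd hd
  unfold Signotope at hs
  grind

lemma Holds.crosses_of_crossing (h : Holds q Q) (hq : IsSorted q) {a x b y : ℕ}
    (hx : x < 10) (hy : y < 10) (hc : crossing Q a x b y) : Crosses (q a) (q x) (q b) (q y) := by
  simp only [crossing, Bool.and_eq_true, Bool.or_eq_true, Nat.blt_eq] at hc
  obtain ⟨⟨⟨hab, hbx⟩, hby⟩, ⟨hxy, hc⟩ | ⟨hyx, hc⟩⟩ := hc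
  · refine hq.crosses_of_iff hab hbx hxy hy ?_
    have p₁ := h.of_isPos hq hab hbx hx
    have p₂ := h.of_isPos hq hbx hxy hy
    have n₁ := h.of_isNeg hab hbx hx
    have n₂ := h.of_isNeg hbx hxy hy
    grind
  · refine hq.crosses_of_not_iff hab hby hyx hx ?_
    have p₁ := h.of_isPos hq hab hbx hx
    have p₂ := h.of_isPos hq (hab.trans hby) hyx hx
    have n₁ := h.of_isNeg hab hbx hx
    have n₂ := h.of_isNeg (hab.trans hby) hyx hx
    grind

/-- No three segments joining the first ten of the points `q` pairwise cross. -/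
def CrossingFree (q : ℕ → ℝ × ℝ) : Prop :=
  ∀ a b c x y z, a < b → b < c → a < x → b < y → c < z → x < 10 → y < 10 → z < 10 →
    Crosses (q a) (q x) (q b) (q y) → Crosses (q a) (q x) (q c) (q z) →
    Crosses (q b) (q y) (q c) (q z) → False

lemma Holds.refuted_eq_false (h : Holds q Q) (hq : IsSorted q) (hfree : CrossingFree q) (n : ℕ) :
    refuted Q n = false := by
  rw [Bool.eq_false_iff]
  intro hr
  have digit : ∀ m, m % 10 < 10 := fun m => Nat.mod_lt m (by norm_num)
  simp only [refuted] at hr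
  split_ifs at hr with hn
  · rw [h.violates_eq_false hq (digit n)] at hr
    exact Bool.false_ne_true hr
  · simp only [Bool.and_eq_true] at hr
    obtain ⟨⟨h₁, h₂⟩, h₃⟩ := hr
    have lt_of_crossing : ∀ {a x b y}, crossing Q a x b y → a < b ∧ b < x ∧ b < y := by
      intro a x b y h
      simp only [crossing, Bool.and_eq_true, Nat.blt_eq] at h
      exact ⟨h.1.1.1, h.1.1.2, h.1.2⟩
    obtain ⟨hab, hbx, hby⟩ := lt_of_crossing h₁
    obtain ⟨hbc, -, hcz⟩ := lt_of_crossing h₃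
    exact hfree _ _ _ _ _ _ hab hbc (hab.trans hbx) hby hcz (digit _) (digit _) (digit _)
      (h.crosses_of_crossing hq (digit _) (digit _) h₁)
      (h.crosses_of_crossing hq (digit _) (digit _) h₂)
      (h.crosses_of_crossing hq (digit _) (digit _) h₃)

lemma Holds.split (h : Holds q Q) {n : ℕ} (hn : n < 1000) :
    Holds q (Q ||| 1 <<< n) ∨ Holds q (Q ||| 1 <<< (1000 + n)) := by
  simp only [Holds, Nat.testBit_or, Nat.one_shiftLeft, Nat.testBit_two_pow, Bool.or_eq_true,
    decide_eq_true_eq]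
  by_cases hpos : 0 < orient (q (n / 100)) (q (n / 10 % 10)) (q (n % 10))
  · refine Or.inl fun a b c ha hb hc => ⟨?_, ?_⟩
    · rintro (hQ | rfl)
      · exact (h a b c ha hb hc).1 hQ
      · convert hpos using 3 <;> omega
    · rintro (hQ | hn')
      · exact (h a b c ha hb hc).2 hQ
      · omega
  · refine Or.inr fun a b c ha hb hc => ⟨?_, ?_⟩
    · rintro (hQ | hn')
      · exact (h a b c ha hb hc).1 hQ
      · omega
    · rintro (hQ | hn')
      · exact (h a b c ha hb hc).2 hQ
      · obtain rfl : n = 100 * a + 10 * b + c := by omega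
        convert hpos using 4 <;> omega

lemma runRow_eq_false (hq : IsSorted q) (hfree : CrossingFree q) {k : List ℕ → Bool}
    (hk : ∀ cases, (∃ Q ∈ cases, Holds q Q) → k cases = false) (row cases : List ℕ)
    (h : ∃ Q ∈ cases, Holds q Q) : runRow k row cases = false := by
  induction row generalizing cases with
  | nil => exact hk cases h
  | cons n row ih =>
    obtain ⟨Q, hQ, hh⟩ := h
    cases cases with
    | nil => simp at hQ
    | cons Q' cases =>
      rw [runRow]
      rcases List.mem_cons.1 hQ with rfl | hQ
      · split_ifs with hn
        · refine ih _ ?_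
          rcases hh.split hn with h | h
          · exact ⟨_, by simp, h⟩
          · exact ⟨_, by simp, h⟩
        · rw [hh.refuted_eq_false hq hfree, Bool.false_and]
      · split_ifs with hn
        · exact ih _ ⟨Q, by simp [hQ], hh⟩
        · rw [ih _ ⟨Q, hQ, hh⟩, Bool.and_false]

lemma run_eq_false (hq : IsSorted q) (hfree : CrossingFree q) (rows : List (List ℕ))
    (cases : List ℕ) (h : ∃ Q ∈ cases, Holds q Q) : run rows cases = false := by
  induction rows generalizing cases with
  | nil =>
    obtain ⟨Q, hQ, -⟩ := h
    exact List.isEmpty_eq_false_iff.2 (List.ne_nil_of_mem hQ)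
  | cons row rows ih => exact runRow_eq_false hq hfree ih row cases h

set_option maxRecDepth 20000 in
/-- A case distinction refuting `CrossingFree` for sorted points, in the format of `run`. -/
def certificate : List (List ℕ) :=
  [[238, 368, 268, 278, 389, 369, 23689, 3689, 689, 3689, 258, 248, 489, 469, 24689, 4689, 589],
   [568, 569, 25689, 5689, 5689, 126, 156, 12568, 146, 12468, 128, 136, 12368, 168, 125, 123, 568],
   [124, 468, 178, 158, 135, 12358, 145, 12458, 235, 1235, 134, 12348, 458, 234, 1234, 147, 127],
   [12478, 1247, 478, 157, 127, 12578, 1257, 578, 347, 357, 34578, 367, 34678, 123657, 367, 357],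
   [35678, 123547, 123647, 1578, 1478, 1458, 1258, 1278, 1468, 1246, 1568, 1236, 1256, 1268, 1268],
   [127, 167, 12678, 1267, 378, 789, 3789, 137, 237, 167, 13678, 267, 23678, 136, 12367, 1367],
   [1237, 267, 237, 23678, 236, 2367, 367, 136, 1236, 125, 128, 156, 1256, 158, 157, 1257, 135],
   [12358, 145, 12458, 178, 168, 146, 1456, 568, 578, 147, 1457, 124, 478, 468, 357, 35678, 134],
   [12348, 347, 34678, 234, 1234, 123547, 1468, 1478, 1245, 1578, 1568, 1268, 1278, 1258, 1258],
   [146, 346, 246, 247, 23476, 2467, 1246, 1346, 147, 167, 247, 346, 13476, 234, 2347, 123746],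
   [1247, 1467, 135, 356, 1356, 357, 1357, 567, 568, 578, 257, 2357, 358, 138, 168, 178, 468, 478],
   [247, 24678, 467, 457, 45678, 456, 4567, 348, 145, 13458, 124576, 34687, 2467, 1478, 1468],
   [13687, 1368, 1358, 35687, 3578, 3568, 3567, 156, 356, 256, 257, 23576, 2567, 1256, 1356, 157],
   [145, 1457, 567, 257, 457, 167, 456, 14576, 345, 247, 23475, 245, 2457, 124756, 134756, 1567],
   [1457, 1257, 1567, 123, 128, 178, 158, 578, 568, 357, 35678, 257, 25678, 356, 3567, 123576],
   [1568, 1578, 1258, 1278, 1238, 124, 134, 12348, 1234, 128, 178, 158, 578, 568, 357, 35678, 257],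
   [25678, 356, 3567, 123576, 1568, 1578, 1258, 1278, 134, 347, 1347, 234, 467, 348, 138, 148],
   [12384, 1348, 1348, 34687, 3467, 1234, 246, 247, 346, 23476, 2346, 2467, 468, 467, 167, 478],
   [247, 24678, 347, 34678, 346, 3467, 123476, 14678, 247, 346, 23476, 478, 24678, 479, 4789, 678],
   [4678, 469, 146798, 369, 3469, 349, 3469, 123469, 478, 346, 347, 34678, 3467, 123476, 2478],
   [2467, 2468, 2367, 678, 167, 1267, 147, 146, 247, 12467, 1247, 1467, 478, 578, 568, 369, 359],
   [35698, 379, 36798, 569, 367, 579, 56798, 357, 35678, 35679, 3679, 3569, 123, 237, 1237, 236],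
   [1236, 136, 1236, 379, 349, 34798, 359, 35798, 357, 3579, 579, 367, 3679, 679, 347, 3479, 479],
   [458, 569, 56798, 567, 5679, 468, 459, 45798, 457, 4579, 467, 4567, 256, 246, 24568, 234697],
   [235697, 46789, 45789, 3479, 3679, 3579, 123679, 124, 134, 12348, 1234, 125, 135, 12358, 1235],
   [236, 367, 2367, 146, 246, 348, 23468, 468, 346, 3468, 234, 136, 12364, 1346, 2348, 3468, 1246],
   [134, 347, 1347, 246, 467, 2467, 348, 23468, 136, 134687, 469, 234689, 479, 34789, 134679],
   [12346, 136, 1346, 128, 138, 348, 246, 23468, 234, 346, 2346, 247, 2467, 347, 2347, 349, 3469],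
   [237, 123476, 379, 479, 467, 469, 46798, 4679, 134697, 3479, 123479, 2346, 1348, 1238, 135, 145],
   [256, 156, 1356, 234, 12354, 456, 1456, 246, 348, 23468, 2348, 2456, 12356, 1345, 138, 168],
   [12386, 1368, 156, 356, 158, 168, 13586, 1568, 1568, 1356, 234, 235, 237, 246, 348, 23468, 247],
   [234786, 123478, 346, 2346, 247, 2467, 123476, 357, 2357, 379, 579, 359, 35798, 567, 569, 56798],
   [5679, 135697, 3579, 123679, 358, 256, 23568, 2356, 2358, 348, 246, 23468, 2346, 2348, 237],
   [2367, 136, 1236, 379, 349, 34798, 359, 35798, 357, 3579, 579, 367, 3679, 679, 347, 3479, 479],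
   [458, 569, 56798, 567, 5679, 468, 459, 45798, 457, 4579, 467, 4567, 256, 246, 24568, 234697],
   [235697, 46789, 45789, 3479, 3679, 3579, 123679, 567, 5678, 679, 56789, 356, 569, 5689, 256],
   [358, 257, 256789, 579, 5679, 156, 236, 23568, 136, 13568, 135, 1356, 235, 2356, 145, 146, 345],
   [13465, 1345, 1456, 456, 146, 345, 13465, 234, 246, 2346, 1246, 123645, 245, 246, 345, 23465],
   [2345, 2456, 458, 468, 346, 34568, 347, 367, 34678, 3467, 357, 367, 34576, 13567, 367, 3567],
   [123657, 14568, 2458, 1456, 125679, 3568, 2568, 3568, 567, 5678, 257, 458, 357, 457, 358, 256],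
   [456, 347, 34578, 367, 34576, 236, 23568, 23567, 4567, 2567, 3578, 4578, 3578, 4578, 2578, 467],
   [4678, 468, 4678, 247, 348, 347, 679, 246, 236, 23468, 367, 369, 379, 36798, 3679, 3679, 23467],
   [2467, 146789, 3478, 3478, 2478, 2678, 237, 678, 3678, 367, 379, 3789, 267, 123, 1237, 679],
   [6789, 124, 134, 12348, 1234, 125, 135, 12358, 1235, 136, 236, 137, 167, 12376, 1367, 1367],
   [1236, 134, 247, 234, 346, 1346, 468, 478, 24678, 347, 147, 137, 12374, 1347, 1347, 34678, 3468],
   [1234, 12347, 135, 145, 356, 1356, 257, 235, 234, 12354, 245, 568, 578, 25678, 347, 357, 23457],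
   [35678, 2347, 3568, 1245, 1235, 12357, 1345, 137, 167, 157, 347, 147, 256, 12576, 246, 12476],
   [245, 12475, 257, 478, 3478, 567, 468, 458, 45687, 2458, 2468, 2567, 1257, 1347, 1347, 1357],
   [1367, 167, 13678, 168, 1678, 369, 136798, 146, 246, 349, 13469, 468, 1468, 234, 236, 348],
   [23468, 3468, 2346, 123649, 1246, 147, 1467, 156, 567, 1567, 356, 568, 1568, 359, 13569, 578],
   [5678, 358, 157, 235, 123758, 123659, 156789, 3568, 1356, 157, 1567, 235, 236, 246, 347, 23467],
   [348, 23468, 467, 479, 469, 234689, 4679, 134789, 3467, 467, 348, 34687, 123468, 2467, 256],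
   [2356, 356, 2356, 359, 3569, 123569, 358, 578, 3578, 567, 35687, 568, 5678, 156789, 2358, 2367],
   [3678, 2378, 456, 24586, 234, 468, 246, 2468, 348, 2348, 467, 24687, 457, 24587, 245, 2458, 346],
   [2346, 678, 356, 3456, 378, 235, 358, 234587, 567, 35687, 345867, 234567, 3678, 4678, 2468],
   [2348, 257, 2578, 358, 2358, 578, 256, 2568, 235, 567, 25687, 357, 2357, 267, 2567, 678, 367],
   [3567, 378, 236, 235687, 125, 135, 124, 123, 128, 138, 158, 168, 126, 156, 136, 12368, 123685],
   [125687, 156, 1256, 127, 1267, 129, 269, 279, 289, 12689, 26798, 1279, 1269, 159, 1259, 589],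
   [1589, 569, 35689, 579, 35789, 125679, 1268, 12385, 1238, 1238, 134, 136, 1236, 234, 146, 1346],
   [245, 12345, 248, 12348, 145, 345, 2345, 456, 1456, 234856, 12354, 1234, 1234, 245, 456, 2456],
   [458, 2458, 248, 348, 345, 23485, 3458, 345867, 245867, 1245, 1235, 135, 12358, 123567, 3678],
   [5678, 2358, 2578, 237, 378, 2378, 367, 23687, 3678, 2378, 2368, 236, 358, 258, 356, 568, 3568],
   [268, 256, 123, 126, 156, 12568, 1256, 1236, 124, 134, 246, 12346, 248, 12348, 456, 24586, 2456],
   [1234, 126, 156, 12568, 1256, 135, 136, 235, 156, 12365, 1356, 1235, 1356, 134, 234, 246, 345],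
   [1345, 458, 468, 24568, 346, 136, 146, 12364, 1346, 1346, 34568, 3458, 12346, 1234, 136, 156],
   [146, 245, 12465, 246, 234, 12364, 456, 348, 34586, 2348, 2456, 1246, 1346, 1356, 156, 13568],
   [146, 348, 13468, 134685, 267, 257, 237, 378, 23578, 567, 357, 367, 23567, 3567, 3578, 135687],
   [2367, 2567, 567, 2567, 278, 367, 2367, 378, 237, 123678, 234, 247, 2347, 347, 2347, 235, 239],
   [279, 679, 689, 26789, 36789, 2679, 2379, 369, 2369, 359, 2359, 379, 135697, 123679, 245, 2345],
   [345, 2345, 357, 456, 457, 348, 34586, 34587, 3457, 2456, 123457, 348, 246, 346, 468, 3468, 456],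
   [34586, 467, 2467, 245, 235, 23456, 458, 4568, 478, 145687, 457, 4567, 578, 347, 357, 345768],
   [23457, 3478, 145678, 2456, 2346, 2346, 2348, 135687, 2678, 2568, 23586, 3568, 2358, 235, 348],
   [345, 468, 3468, 248, 346, 258, 245, 246, 268, 356, 23456, 456, 3456, 256, 125, 135, 12358],
   [1235, 126, 146, 12468, 1246, 135, 145, 234, 12354, 136, 156, 12365, 146, 13465, 1346, 146],
   [13468, 156, 1356, 237, 347, 247, 378, 23478, 367, 23467, 467, 3467, 134687, 2347, 2347, 378],
   [267, 2367, 567, 2567, 135687, 2378, 1345, 145, 13458, 134586, 23465, 23486, 2468, 2345, 23485],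
   [3468, 2348, 3458, 234, 138, 134, 135, 136, 345, 145, 245, 125, 124, 12345, 258, 12358, 248],
   [23485, 12348, 12354, 2345, 1345, 346, 456, 356, 246, 245, 23456, 124, 12346, 123456, 2346],
   [3456, 3456, 146, 126, 156, 268, 12368, 125, 145, 258, 12358, 256, 12356, 124, 246, 12346, 248],
   [12348, 127, 137, 278, 12378, 147, 157, 167, 237, 267, 12367, 257, 12357, 247, 12347, 458, 468],
   [14568, 478, 14578, 234768, 468, 478, 14678, 234758, 234658, 2378, 12376, 12375, 12374, 378],
   [147, 1347, 278, 467, 1467, 234867, 2378, 1378, 157, 1257, 167, 1267, 457, 1457, 467, 1467],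
   [234657, 245, 248, 456, 2456, 234856, 12348, 12345, 12354, 256, 258, 145, 12354, 456, 248],
   [24586, 124, 458, 246, 12346, 468, 14568, 24568, 2458, 12348, 1456, 12358, 1256, 12365, 12364],
   [126, 12364, 268, 156, 12365, 125, 256, 1256, 145, 258, 12358, 456, 1456, 248, 458, 2458, 124],
   [12348, 468, 246, 234658, 12346, 134658, 234856, 12354, 256, 258, 145, 12354, 124, 245, 1245],
   [248, 12348, 456, 24586, 2456, 246, 127, 167, 278, 12678, 567, 25687, 1567, 1267, 128, 158, 168],
   [458, 468, 24568, 1468, 1458, 12586, 12385, 168, 12386, 148, 12384, 137, 147, 12374, 237, 157],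
   [12375, 167, 12376, 247, 267, 257, 458, 468, 24568, 478, 24578, 134768, 468, 478, 24678, 134758],
   [134658, 12357, 12367, 12347, 1237, 178, 467, 237, 12387, 247, 123874, 2467, 134867, 1378],
   [12346, 12358, 12356, 12368, 1368, 1358, 1348, 123, 1238, 148, 1348, 158, 1358, 128, 1238, 168],
   [1368, 139, 239, 189, 389, 129, 289, 489, 159, 149, 258, 125, 1258, 259, 359, 23589, 135, 145],
   [12354, 134, 459, 248, 24589, 124, 458, 249, 12349, 24598, 2458, 12348, 1459, 1345, 1359, 2589],
   [134, 124, 245, 12345, 249, 12349, 345, 2345, 349, 2349, 125, 135, 145, 259, 12359, 458, 1458],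
   [234958, 12354, 1235, 259, 135, 12358, 359, 458, 24598, 234598, 123589, 1259, 248, 249, 345],
   [23485, 349, 23489, 459, 259, 359, 234895, 135, 125, 12359, 12358, 1359, 2459, 234859, 1249],
   [12348, 124, 1234, 349, 249, 248, 23489, 345, 245, 259, 359, 23459, 135, 125, 12359, 12358],
   [1359, 23495, 2345, 123485, 1249, 1349, 12394, 12395, 1489, 2389, 12398, 1389, 1389, 1239, 129],
   [1239, 149, 134, 1349, 349, 189, 248, 489, 389, 23489, 3489, 1489, 123984, 1489, 1349, 159, 359],
   [189, 389, 258, 23589, 123985, 3589, 1589, 1359, 169, 689, 369, 189, 389, 268, 23689, 123986],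
   [3689, 1689, 1369, 1689, 378, 347, 3478, 478, 678, 357, 3578, 578, 278, 367, 3678, 349, 489],
   [379, 389, 23789, 3489, 3479, 3489, 359, 389, 379, 23789, 3579, 3589, 369, 389, 379, 268, 23689],
   [258, 235896, 235897, 3679, 3689, 379, 479, 579, 489, 589, 258, 25789, 458, 45789, 248, 24789],
   [459, 457, 4578, 345, 3459, 234857, 45798, 35789, 34789, 3579, 3479, 679, 689, 468, 46789, 568],
   [56789, 268, 26789, 467, 4678, 567, 5678, 267, 2678, 124, 134, 248, 1248, 246, 12346, 346, 2346],
   [234867, 1234, 125, 258, 1258, 135, 256, 12356, 356, 2356, 235867, 1235, 126, 146, 136, 469],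
   [1469, 134, 248, 346, 23486, 489, 234869, 479, 34789, 459, 345897, 135, 258, 145, 12354, 456],
   [24586, 1456, 12358, 145, 1345, 134579, 12348, 346, 248, 23486, 247, 2478, 237, 123478, 123479],
   [1346, 1236, 1246, 136, 12368, 237, 123678, 123679, 36789, 689, 6789, 467, 567, 468, 458, 568],
   [145, 1458, 457, 45678, 135, 456, 4567, 125, 12354, 256, 246, 24568, 2456, 12356, 134587, 5678],
   [45687, 4678, 356879, 346879, 2378, 3578, 3678, 3478, 237, 379, 279, 789, 389, 289, 278, 23789],
   [124, 134, 247, 12347, 249, 1249, 349, 1349, 478, 24798, 234798, 1234, 134, 349, 1349, 248],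
   [234897, 12348, 247, 349, 23479, 248, 234897, 123489, 248, 2478, 347, 2347, 123487, 2789, 3789],
   [3789, 2379, 349, 489, 347, 389, 249, 239, 279, 248, 23489, 278, 234897, 127, 1279, 137, 12378],
   [123789, 23497, 2349, 2349, 3489, 3479, 3489, 359, 459, 579, 3579, 357, 389, 259, 458, 34598],
   [245, 457, 257, 347, 23457, 247, 479, 24579, 234579, 2457, 2579, 4579, 234598, 2359, 3589, 3579],
   [3459, 369, 389, 468, 34698, 568, 35698, 367, 456, 356, 3569, 246, 569, 346, 3469, 256, 567],
   [347, 23467, 357, 34576, 467, 579, 457, 245679, 4567, 345769, 3467, 3567, 235698, 3569, 234698],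
   [345968, 3679, 3689, 126, 268, 1268, 136, 146, 267, 12367, 156, 468, 1468, 469, 1469, 568, 1568],
   [124, 134, 248, 1248, 247, 12347, 246, 12346, 346, 2346, 478, 479, 489, 678, 46798, 4678],
   [234869, 234769, 234768, 1234, 246, 125, 258, 1258, 259, 1259, 145, 245, 256, 12456, 459, 2459],
   [456, 2456, 356, 2356, 345, 23465, 346, 3456, 248, 234856, 489, 345698, 234859, 1245, 1245, 135],
   [258, 145, 12354, 134, 456, 248, 24586, 12348, 1456, 1345, 12358, 356, 258, 23586, 257, 23576],
   [134, 247, 346, 23476, 234765, 12347, 346, 245, 23456, 248, 23486, 345, 2345, 123485, 1346],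
   [1356, 1246, 12365, 12364, 1236, 267, 246, 247, 124, 1246, 125, 258, 1258, 145, 156, 1256, 135],
   [257, 12357, 245, 456, 1456, 567, 345, 23475, 457, 2457, 134, 248, 278, 268, 25687, 234856],
   [234857, 12348, 1345, 2567, 1245, 1235, 1245, 248, 257, 258, 127, 278, 1278, 157, 578, 2578],
   [457, 24587, 357, 23587, 478, 2478, 347, 23487, 579, 1579, 458, 4578, 589, 245879, 345789, 1257],
   [147, 137, 12374, 167, 12476, 347, 146, 367, 23467, 136, 12364, 13467, 1467, 1347, 239, 249],
   [245, 146, 136, 12364, 156, 12465, 346, 145, 356, 23456, 135, 12354, 13456, 1456, 1346, 268],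
   [346, 356, 23456, 468, 3468, 469, 3469, 456, 3456, 136, 1346, 156, 1356, 458, 4568, 459, 4569],
   [489, 568, 589, 689, 569, 25689, 5689, 4689, 4589, 145698, 134689, 347, 367, 23467, 3467, 459],
   [479, 24579, 489, 24589, 157, 124759, 578, 458, 478, 24578, 4578, 4589, 145798, 136, 156, 12365],
   [135, 145, 12354, 345, 1345, 469, 489, 24689, 479, 24679, 167, 14679, 137, 157, 145796, 134759],
   [134789, 134659, 1356, 137, 167, 12376, 1367, 156, 145, 1456, 456, 345, 3456, 469, 4569, 134659],
   [1456, 256, 356, 568, 3568, 135, 1356, 569, 3569, 345, 3456, 145, 1345, 489, 469, 4569, 145698],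
   [134589, 357, 367, 23567, 3567, 456, 569, 4569, 469, 4569, 589, 568, 5689, 489, 345698, 134689],
   [135689, 457, 467, 24567, 4567, 458, 468, 24568, 4568, 468, 568, 478, 24678, 578, 25678, 467],
   [245678, 4678, 4568, 167, 467, 478, 4678, 134768, 1467, 367, 567, 467, 678, 3678, 469, 479],
   [45697, 345796, 479, 4679, 489, 146798, 134689, 3467, 3567, 478, 578, 567, 568, 25678, 5678],
   [345687, 4578, 134678, 356, 2356, 135, 12356, 568, 145, 12456, 469, 489, 45698, 134589, 134569],
   [2568, 136, 12368, 256, 278, 2678, 367, 357, 23567, 235876, 123687, 2568, 134, 12345, 459, 137],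
   [1347, 479, 24579, 489, 24589, 134789, 2459, 489, 2489, 134, 12349, 289, 2489, 123498, 249],
   [2349, 489, 2489, 479, 2479, 137, 347, 1347, 157, 12375, 135, 134, 145, 12354, 245, 345, 1345],
   [459, 2459, 134759, 12345, 1347, 1357, 134789, 278, 2578, 135, 12358, 357, 347, 23487, 234875],
   [123587, 357, 2357, 567, 245, 256, 2567, 345, 23475, 457, 2457, 135, 12357, 145, 12457, 356],
   [3567, 456, 4567, 467, 124567, 346, 3456, 134567, 2457, 2567, 478, 2478, 134, 12348, 268, 2468],
   [278, 2478, 347, 136, 12368, 367, 23467, 123687, 123487, 2467, 467, 346, 2346, 146, 1246, 256],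
   [456, 257, 245, 2456, 345, 3456, 247, 145, 1456, 124, 134, 12347, 1234, 134, 12345, 356, 123456],
   [135, 1345, 136, 1346, 156, 1356, 248, 468, 458, 478, 24678, 578, 4578, 567, 45687, 568, 5678],
   [367, 3567, 357, 3567, 135678, 2458, 2468, 478, 2478, 278, 2478, 347, 258, 357, 23587, 234875],
   [123485, 123487, 24576, 2567, 2456, 567, 356, 2356, 156, 1256, 248, 124, 1248, 268, 278, 134],
   [12346, 345, 258, 459, 3459, 125, 1258, 135, 12356, 145, 123564, 489, 469, 24689, 134569],
   [134589, 25687, 123465, 24687, 2468, 124, 134, 247, 12347, 245, 12345, 347, 2347, 345, 2345],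
   [125, 135, 257, 12357, 145, 456, 1456, 234756, 12354, 1235, 135, 12356, 258, 268, 278, 24687],
   [25687, 2568, 268, 278, 25687, 357, 367, 234876, 235876, 123587, 123586, 1234, 134, 12348, 268],
   [278, 24687, 367, 23687, 347, 234876, 123487, 123486, 2567, 2467, 367, 2367, 127, 1267, 136],
   [12367, 167, 1267, 146, 247, 12467, 123674, 147, 1467, 156, 257, 12567, 123675, 278, 678, 346],
   [468, 3468, 469, 3469, 247, 23476, 478, 347, 134678, 479, 489, 46798, 134689, 134679, 124678],
   [347, 3467, 356, 257, 23576, 569, 3569, 579, 589, 56798, 135689, 125679, 469, 134, 124, 248],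
   [1248, 247, 12347, 245, 12345, 345, 2345, 125, 258, 1258, 135, 145, 457, 1457, 234857, 12354],
   [1235, 145, 1245, 135, 258, 257, 457, 24587, 2457, 123574, 12358, 257, 258, 457, 24587, 2457],
   [2578, 123576, 247, 248, 467, 2467, 479, 489, 24789, 46798, 4679, 12348, 12347, 124, 1234, 247],
   [248, 467, 2467, 479, 489, 24789, 46798, 4679, 2478, 123476, 479, 489, 46798, 134689, 134679],
   [2678, 268, 2678, 123687, 2378, 2348, 2358, 2368, 378, 237, 2378, 368, 236, 2368, 358, 235],
   [2358, 137, 127, 157, 13578, 167, 13678, 356, 136, 156, 13568, 1356, 1367, 123756, 1237, 234],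
   [246, 2346, 348, 2348, 245, 2345, 345, 2345, 346, 2346, 457, 34587, 467, 34687, 456, 34586, 356],
   [3456, 234567, 348, 136, 146, 13468, 126, 156, 13568, 134, 345, 135, 145, 13458, 1345, 1356],
   [123645, 1346, 1236, 589, 359, 579, 35789, 789, 569, 35689, 689, 356, 679, 36789, 678, 6789],
   [345, 346, 147, 157, 13475, 167, 13476, 156798, 145, 157, 1457, 457, 1457, 167, 456, 567, 4567],
   [1567, 145769, 156798, 146, 156, 13465, 1456, 157, 457, 167, 13576, 467, 34567, 156, 134657],
   [1567, 1457, 167, 456, 567, 467, 457, 34567, 4567, 1467, 1567, 145769, 156798, 3456, 459, 489],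
   [34589, 4589, 3459, 3569, 5689, 5789, 3589, 489, 459, 34589, 4589, 289, 248, 249, 259, 389, 258],
   [239, 345, 23485, 359, 459, 245, 2345, 123, 129, 189, 158, 148, 138, 13589, 128, 12589, 123845],
   [1489, 1589, 1289, 1239, 134, 1234, 124, 1234, 246, 456, 346, 268, 23486, 24586, 2346, 2456],
   [256, 123465, 469, 268, 568, 45698, 2568, 2468, 2469, 3459, 2359, 23498, 2589, 2389, 2589, 2489],
   [2489, 239, 2389, 135, 138, 356, 1356, 158, 357, 1357, 145, 13458, 156, 1356, 157, 1357, 125],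
   [168, 128, 568, 578, 345, 1345, 124, 146, 1456, 245, 1245, 147, 1457, 346, 3456, 347, 3457, 126],
   [367, 567, 456, 467, 457, 45678, 4567, 3467, 234576, 3567, 123647, 268, 127, 167, 123746, 1267],
   [278, 367, 23687, 267, 2367, 678, 129, 269, 279, 259, 25698, 567, 256978, 235967, 1279, 1269],
   [139, 1239, 389, 1389, 369, 23689, 379, 23789, 123679, 3678, 1278, 1268, 1245, 1578, 3568, 1238],
   [1368, 1235, 1358, 1358, 189, 158, 128, 129, 159, 149, 148, 139, 359, 379, 369, 124, 125, 126],
   [134, 347, 1347, 146, 1346, 346, 1346, 145, 1345, 367, 357, 356, 456, 34576, 3456, 123546],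
   [123547, 123647, 349, 138, 168, 178, 389, 13689, 478, 34798, 578, 35798, 458, 34598, 147, 157],
   [345, 13475, 3458, 1578, 1478, 1378, 1368, 345, 13485, 459, 145, 1345, 146, 456, 346, 168],
   [13486, 14586, 1346, 1456, 469, 156, 123645, 168, 568, 45698, 1568, 1468, 1469, 3459, 1349, 156],
   [1256, 268, 569, 258, 356, 23586, 123586, 25689, 1569, 1268, 258, 245, 1245, 259, 458, 389, 459],
   [349, 138, 13489, 248, 345, 13485, 134, 1348, 123485, 24589, 34598, 2459, 23589, 2458, 1259],
   [1258, 249, 248, 349, 389, 138, 13489, 345, 13485, 459, 458, 259, 24598, 2459, 3458, 3459],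
   [23489, 2349, 1248, 1249, 1369, 1379, 1359, 13598, 1489, 1489, 1589, 1289, 1289, 1589, 139, 179],
   [13798, 1379, 349, 134, 1349, 359, 369, 138, 168, 389, 1389, 468, 34698, 458, 34598, 568, 35698],
   [146, 345, 156, 13465, 1568, 3458, 1468, 1368, 469, 689, 4689, 468, 146, 148, 168, 346, 13486],
   [1346, 1468, 1468, 145, 345, 456, 1456, 569, 458, 148, 158, 13485, 1458, 1458, 45689, 4569],
   [1345, 147, 467, 167, 157, 345, 13475, 479, 14679, 478, 14678, 678, 4678, 459, 567, 45697],
   [456978, 3459, 1457, 1467, 1467, 148, 158, 168, 178, 357, 13587, 356, 13586, 367, 13687, 347],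
   [13487, 125, 123547, 256, 2356, 123567, 1478, 1468, 1458, 168, 14689, 158, 459, 14589, 145896],
   [128, 126, 124, 125, 245, 1245, 459, 568, 45698, 458, 356, 569, 5689, 346, 34568, 345, 3456],
   [256, 156, 123645, 1256, 125869, 3568, 4589, 124859, 1258, 1248, 1268, 246, 248, 346, 268],
   [23486, 2468, 2346, 2468, 245, 456, 2456, 345, 569, 458, 248, 258, 23485, 2458, 2458, 45689],
   [4569, 2345, 247, 467, 257, 345, 23475, 127, 1247, 124, 1247, 267, 356, 23576, 346, 3456],
   [123456, 2467, 2457, 2467, 248, 268, 124, 1248, 278, 347, 23487, 367, 23687, 123467, 2478, 2468],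
   [268, 24689, 258, 459, 24589, 245896, 278, 479, 24789, 246897, 356, 127, 125, 126, 156, 456],
   [345, 346, 458, 34568, 4568, 3456, 123645, 1456, 256, 1256, 157, 567, 167, 13576, 1567, 1567],
   [167, 567, 346, 478, 458, 34568, 45687, 14678, 123746, 1567, 345, 346, 458, 34568, 569, 345689],
   [456, 4568, 4569, 3456, 459, 568, 45698, 578, 479, 45798, 456987, 125768, 3459, 156, 1256, 167],
   [569, 346, 458, 34568, 345689, 123746, 125689, 1267, 157, 459, 457, 345, 357, 479, 347, 34579],
   [3457, 14579, 1357, 123745, 1457, 124589, 1257, 479, 678, 46798, 367, 357, 347, 34679, 456],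
   [34576, 345, 3457, 3456, 3567, 3678, 124789, 568, 459, 45698, 346, 234569, 125, 123546, 124589],
   [3568, 4689, 346, 169, 149, 13496, 1469, 179, 679, 178, 689, 36789, 168, 367, 13687, 148, 13486],
   [347, 134876, 479, 14789, 134879, 16789, 1789, 1679, 269, 249, 23496, 2469, 279, 679, 789, 2789],
   [278, 689, 36789, 268, 367, 23687, 126, 123687, 123697, 26789, 2789, 2679, 459, 569, 4569, 456],
   [458, 356, 468, 34568, 568, 4568, 145, 156, 146, 345, 13465, 1345, 1456, 1456, 146, 156, 345],
   [13465, 126, 245, 2345, 147, 157, 167, 13476, 14576, 1457, 148, 158, 168, 13486, 14586, 1458],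
   [168, 1468, 268, 1268, 157, 478, 357, 347, 34578, 367, 34576, 13567, 1357, 14578, 246, 256, 124],
   [123465, 127, 1247, 248, 258, 24586, 2458, 258, 24589, 278, 479, 246897, 245897, 579, 479, 578],
   [45798, 5789, 124789, 125789, 2456, 256, 24568, 245698, 123645, 1456, 156, 14568, 145698, 3569],
   [4589, 4569, 345, 347, 148, 158, 13485, 178, 13487, 478, 1478, 168, 13486, 145, 146, 147, 357],
   [156, 13465, 456, 1456, 367, 157, 13475, 569, 579, 35679, 457, 1457, 145879, 145869, 13467],
   [13457, 1478, 1468, 1458, 248, 278, 23487, 258, 23485, 268, 23486, 247, 245, 246, 257, 23475],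
   [457, 2457, 357, 256, 23465, 367, 456, 2456, 579, 569, 35679, 245869, 245879, 23467, 23457],
   [2468, 2458, 2478, 356, 157, 147, 13475, 457, 167, 13576, 467, 34567, 156, 146, 13465, 134657],
   [1567, 1457, 158, 178, 357, 13587, 134875, 1578, 168, 146, 1468, 468, 569, 135869, 458, 34568],
   [456, 4568, 145869, 1468, 257, 579, 2579, 127, 1257, 247, 23475, 357, 457, 479, 4579, 147, 1247],
   [278, 478, 458, 34578, 4578, 2478, 124789, 2457, 2357, 258, 458, 278, 578, 478, 357, 34578],
   [234875, 4578, 2578, 2578, 2458, 156, 146, 13465, 167, 1567, 567, 1567, 145, 1456, 569, 1569],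
   [568, 1568, 147, 1467, 125, 268, 2568, 124, 246, 1246, 256, 124569, 479, 245697, 127, 124769],
   [278, 578, 579, 256897, 457, 467, 34567, 245678, 245879, 2578, 124789, 1245, 124589, 145, 456],
   [1456, 458, 1458, 457, 1457, 357, 256, 246, 23465, 2456, 125, 268, 569, 25689, 245869, 126, 124],
   [146, 468, 1468, 245, 123654, 367, 246, 2456, 247, 2457, 569, 579, 35679, 478, 456897, 245789],
   [245689, 13467, 246, 1246, 245, 147, 127, 123754, 1247, 247, 1247, 267, 479, 467, 4679, 2467],
   [124679, 278, 579, 235879, 245879, 127, 167, 567, 679, 1679, 678, 1678, 468, 478, 45687, 14678],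
   [569, 478, 4678, 689, 5689, 246789, 145689, 1567, 479, 579, 478, 345789, 4789, 4579, 124769],
   [579, 479, 789, 5789, 478, 345789, 4789, 124789, 125789, 124659, 146, 245, 123654, 1245, 1246],
   [569, 146, 689, 5689, 568, 367, 578, 35678, 267, 25678, 678, 5678, 579, 35679, 256798, 13467],
   [5689, 124689, 125689, 126, 1256, 246, 123564, 146, 1246, 268, 569, 25689, 245869, 124689],
   [13457, 146, 1456, 125, 245, 1245, 126, 124659, 256, 1256, 246, 2456, 268, 468, 569, 25689, 458],
   [34568, 456, 4568, 245869, 2468, 124689, 124589, 245, 23456, 156, 1356, 256, 2356, 145, 13456],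
   [569, 246, 2456, 146, 1456, 126, 124659, 125, 258, 124589, 268, 25689, 124689, 124569, 3569],
   [367, 3467, 478, 357, 3457, 679, 678, 579, 689, 36789, 569, 56798, 458, 468, 356, 34568, 3569],
   [46789, 45789, 3579, 3678, 3679, 3478, 3459, 3469, 246, 23469, 346, 356, 389, 3689, 468, 458],
   [34568, 345986, 234698, 3569, 3469, 345, 245, 23459, 389, 3589, 145, 13459, 458, 248, 23489],
   [146, 156, 13465, 1456, 156, 468, 369, 34698, 134695, 134658, 126, 369, 468, 34698, 345986],
   [123659, 268, 369, 23689, 234896, 369, 468, 34698, 345986, 123689, 234598, 3459, 149, 1349, 389],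
   [3489, 689, 3689, 347, 134, 1347, 479, 3479, 379, 3479, 157, 359, 13579, 357, 127, 147, 345],
   [13475, 145, 1345, 245, 2345, 458, 125, 123549, 124, 478, 34578, 257, 247, 123479, 24578],
   [123579, 123459, 3458, 123749, 123759, 1357, 124, 247, 123479, 248, 123489, 127, 147, 359],
   [134795, 123759, 123749, 147, 123749, 278, 145, 457, 1457, 345, 357, 359, 3459, 579, 3579, 258],
   [23587, 245879, 13457, 1345, 125, 359, 258, 23589, 235897, 123549, 257, 258, 357, 23587, 2357],
   [2578, 459, 258, 24589, 245897, 124579, 123789, 247, 248, 278, 23487, 127, 257, 1257, 359],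
   [234795, 123759, 123789, 123489, 123479, 247, 2347, 478, 147, 1347, 124, 145, 157, 1457, 125],
   [457, 1457, 459, 1459, 134, 1345, 357, 3457, 359, 3459, 245, 123459, 248, 123489, 479, 379],
   [234597, 258, 123589, 127, 123759, 278, 245897, 123789, 234579, 1245, 125, 359, 357, 459, 457],
   [479, 578, 45798, 379, 34597, 157, 13579, 135798, 34579, 3457, 3459, 123547, 123549, 127, 157],
   [457, 345, 3457, 123745, 1457, 1257, 128, 258, 278, 359, 23589, 357, 23587, 379, 23789, 257],
   [2357, 123579, 1278, 1258, 148, 1248, 248, 1248, 146, 468, 1468, 467, 1467, 167, 1467, 268],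
   [2468, 679, 46789, 278, 246879, 126789, 126, 367, 369, 268, 1268, 167, 1267, 467, 379, 34697],
   [278, 236897, 679, 3679, 126789, 3467, 123649, 123647, 258, 459, 24589, 345, 357, 3457, 479],
   [278, 24789, 245897, 134579, 234859, 359, 268, 369, 234896, 235896, 369, 456, 34596, 568, 35698],
   [345968, 123689, 123589, 134, 1234, 379, 248, 278, 23789, 234897, 123489, 123479, 3478, 248],
   [2348, 468, 346, 3468, 457, 34587, 458, 467, 34687, 456, 34586, 245, 2458, 356, 3456, 234567],
   [3458, 3468, 356, 3568, 258, 2358, 567, 35687, 568, 357, 3578, 578, 367, 3567, 256, 2356, 257],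
   [2578, 267, 2567, 678, 137, 127, 167, 13678, 157, 135786, 235, 12375, 123756, 1237, 167, 1367],
   [157, 1357, 139, 179, 379, 189, 169, 579, 679, 589, 689, 56789, 569, 789, 6789, 168, 158, 15689],
   [178, 138, 156, 1568, 389, 13789, 136, 135687, 369, 36798, 1369, 135867, 1789, 1689, 56798],
   [35789, 1679, 1579, 16798, 13798, 1379, 1379, 136, 156, 169, 1369, 569, 1569, 579, 589, 5689],
   [35789, 235679, 135687, 156, 1356, 146, 145, 134, 1346, 347, 134675, 346, 345, 478, 234, 2346],
   [458, 3458, 468, 345687, 246, 126, 245, 12465, 2456, 123647, 245687, 3478, 1345, 1346, 1456],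
   [147, 1467, 149, 179, 169, 189, 13798, 16798, 1469, 1479, 158, 138, 189, 1389, 589, 1589, 569],
   [35689, 579, 35789, 135679, 1358, 138, 168, 128, 235, 12385, 126, 123657, 268, 278, 235867],
   [2678, 1268, 1238, 1368, 134, 348, 1348, 346, 1346, 456, 467, 34687, 345, 3456, 246, 2346, 245],
   [2456, 145, 1456, 457, 345876, 235, 135, 125, 234, 12354, 2345, 124567, 134567, 234567, 345867],
   [145, 456, 1456, 458, 1458, 159, 1459, 467, 4567, 348, 234, 2348, 135, 359, 1359, 246, 347],
   [234675, 346, 478, 468, 345687, 145687, 3478, 2346, 247, 2467, 248, 278, 268, 235867, 245867],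
   [2478, 268, 278, 235867, 2678, 278, 126, 478, 347, 468, 346, 345687, 3467, 245687, 123647, 2478],
   [124687, 369, 389, 35698, 379, 36798, 3679, 379, 135697, 389, 3689, 127, 123769, 123789, 13458],
   [345867, 135, 1345, 125, 124, 234, 1234, 346, 347, 456, 3456, 134576, 123547, 123546, 1245],
   [123567, 5678, 3578, 3568, 268, 2368, 678, 367, 3678, 689, 679, 137, 178, 138, 127, 128, 168],
   [16789, 167, 1678, 236, 12386, 123768, 1278, 1237, 1378, 1378, 167, 1367, 168, 178, 16789, 1678],
   [467, 468, 478, 46789, 4678, 4678, 468, 478, 46789, 4678, 567, 578, 568, 56789, 5678, 5678, 568],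
   [578, 56789, 5678, 348, 234, 2348, 346, 134, 138, 148, 13486, 1348, 1348, 135, 145, 356, 13456],
   [345, 358, 13458, 456, 3456, 345867, 1345, 1345, 138, 148, 13486, 1348, 156, 356, 136, 146, 139],
   [359, 389, 379, 369, 13569, 36798, 1379, 1389, 1359, 169, 1369, 369, 1369, 569, 1569, 157, 357],
   [358, 456, 34586, 345, 145, 147, 13475, 1457, 1456, 3456, 3578, 1357, 147, 145, 347, 357, 456],
   [34576, 578, 345768, 145768, 13457, 1347, 1457, 148, 178, 347, 13487, 128, 236, 246, 12486],
   [123864, 123867, 123847, 1478, 158, 358, 178, 357, 135876, 347, 134875, 235, 2358, 128, 123847],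
   [123857, 1578, 1358, 235, 345, 245, 23456, 2345, 2345, 256, 236, 246, 127, 125, 124, 145, 12456],
   [245, 1245, 456, 358, 34586, 458, 3458, 357, 3578, 478, 347, 134578, 123547, 124758, 1456, 1247],
   [1257, 128, 178, 347, 357, 578, 456, 34576, 345768, 1578, 123857, 123847, 1278, 257, 357, 358],
   [456, 34586, 345, 457, 4567, 247, 23475, 2457, 3456, 3578, 2357, 258, 125, 1258, 358, 278, 456],
   [34586, 357, 235876, 145, 245, 347, 23457, 123547, 2456, 1456, 2578, 2358, 345, 349, 125, 145],
   [12456, 124, 245, 1245, 456, 359, 34596, 358, 34586, 458, 3458, 578, 457, 4578, 389, 379, 35798],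
   [234597, 234598, 3578, 1456, 1245, 145, 358, 359, 456, 34586, 389, 379, 36798, 345967, 345968],
   [13459, 13458, 456, 359, 34596, 358, 34586, 379, 389, 578, 356987, 3578, 123589, 123579, 1456],
   [359, 3459, 389, 3489, 125, 145, 12456, 123549, 123589, 456, 358, 34586, 3458, 3456, 2346, 246],
   [23468, 358, 23568, 234685, 236, 2356, 246, 23468, 358, 589, 235689, 456, 34586, 458, 4568],
   [245689, 235687, 1346, 146, 13468, 358, 13568, 134685, 1356, 136, 1356, 358, 146, 13468, 456],
   [34586, 235, 2358, 458, 4568, 457, 4567, 478, 145687, 578, 347, 357, 345768, 245, 23457, 234576],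
   [3478, 145678, 135687, 3468, 248, 2348, 347, 3478, 478, 247, 2478, 147, 1347, 138, 128, 236],
   [12386, 246, 148, 12486, 123864, 234687, 1238, 148, 1348, 157, 145, 1457, 457, 357, 358, 345876],
   [3578, 1357, 1457, 158, 358, 178, 457, 14587, 345, 3458, 134857, 1578, 1358, 357, 457, 358],
   [345876, 3578, 3457, 578, 479, 489, 459, 469, 136, 134, 124, 135, 125, 123, 126, 139, 179, 189],
   [389, 379, 579, 589, 359, 349, 369, 458, 45789, 156, 13569, 146, 13469, 145687, 36798, 34798],
   [35798, 1589, 1579, 1379, 1389, 1389, 1379, 149, 1349, 349, 1349, 249, 1249, 145, 1459, 146],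
   [1469, 346, 3469, 345, 3459, 245, 2459, 234, 12354, 356, 123546, 156, 457, 14567, 235, 2345],
   [234567, 123645, 1236, 236, 246, 12346, 256, 12356, 458, 345, 234658, 457, 245678, 234657],
   [245687, 1236, 145, 1245, 123, 1235, 236, 256, 246, 12346, 346, 2346, 458, 24568, 457, 24567],
   [356, 134567, 345687, 12356, 1236, 156, 145, 1345, 345, 1345, 146, 14569, 457, 14567, 358, 458],
   [14568, 3458, 134587, 1356, 123, 1234, 236, 246, 256, 24569, 245, 356, 2356, 345, 234659, 458],
   [2458, 346, 3456, 345687, 2456, 12346, 1236, 146, 346, 156, 14569, 345, 134659, 456, 356, 34569],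
   [3456, 3456, 1346, 1346, 146, 156, 14569, 358, 134685, 135687, 134687, 46798, 45798, 34789, 489],
   [4789, 469, 346897, 278, 234879, 379, 3479, 349, 3479, 127, 246, 369, 3469, 236, 234, 124, 134],
   [12346, 1234, 1247, 123749, 123769, 124769, 124789, 3578, 3478, 6789, 679, 36789, 389, 3689],
   [369, 3689, 278, 236879, 379, 3679, 123, 126, 127, 136, 234, 348, 2348, 146, 467, 478, 147, 167],
   [468, 14678, 4678, 1467, 1467, 3478, 346879, 12364, 137, 178, 167, 168, 146, 147, 348, 13478],
   [467, 478, 468, 14678, 4678, 3478, 346879, 1467, 468, 478, 348, 3468, 147, 14678, 123748, 4678],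
   [1468, 1678, 136789, 1378, 167, 1367, 236, 246, 147, 12476, 468, 2468, 349, 478, 347, 346789],
   [3479, 134798, 123749, 2346, 123769, 167, 1367, 236, 1236, 137, 1367, 123769, 137, 1237, 123789],
   [136, 236, 1236, 1236, 123689, 127, 1237, 137, 1237, 123789, 3678, 278, 2378, 368, 678, 3678],
   [236, 2368, 367, 358, 578, 3578, 567, 35687, 357, 235, 2358, 568, 5678, 356, 135, 136, 156],
   [13567, 1356, 1356, 136, 156, 13567, 1356, 345, 347, 348, 478, 3478, 467, 34687, 457, 34587],
   [468, 4678, 458, 4578, 237, 267, 256, 246, 23465, 2467, 2567, 2367, 267, 23678, 257, 23578, 247],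
   [23478, 126, 124, 125, 146, 156, 13465, 245, 123654, 256, 1256, 246, 2456, 245678, 156, 246],
   [1246, 145, 1456, 256, 124567, 245678, 145678, 145, 1245, 124578, 146, 246, 156, 13465, 245],
   [123654, 456, 1456, 2456, 1246, 1246, 156, 146, 13465, 124678, 125678, 3458, 3457, 457, 456],
   [348, 34587, 34586, 3456, 3457, 3567, 3578, 356, 3568, 258, 2358, 568, 567, 256, 2356, 156, 167],
   [136, 157, 578, 15678, 357, 13567, 135678, 1567, 1356, 1567, 136, 126, 235, 12365, 123658, 1236],
   [248, 348, 247, 245, 478, 2478, 347, 345, 235, 237, 257, 357, 23457, 578, 2578, 35678, 23475],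
   [23478, 23458, 3458, 3478, 2458, 2478, 2348, 456, 468, 458, 457, 467, 478, 347, 34678, 578],
   [45678, 357, 34576, 345768, 45687, 4567, 4567, 4568, 4568, 459, 469, 479, 569, 489, 348, 34689],
   [347, 34679, 589, 468, 478, 458, 45689, 45687, 34678, 3468, 35689, 45698, 4569, 45697, 4569],
   [239, 389, 289, 369, 269, 359, 259, 489, 349, 245, 469, 45698, 235, 23459, 346, 23456, 3469],
   [2459, 3459, 2489, 25698, 35698, 2369, 2369, 2389, 2389, 249, 289, 348, 23498, 269, 23698],
   [234986, 2489, 347, 478, 3478, 458, 468, 45687, 4568, 138, 168, 178, 137, 135, 167, 158, 147],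
   [145, 357, 13457, 578, 345, 157, 15678, 13475, 3457, 35678, 1458, 1478, 15687, 1678, 1358, 1378],
   [13687, 1368, 158, 1358, 178, 1378, 139, 129, 169, 189, 389, 369, 124, 159, 359, 145, 349, 235],
   [2359, 135, 13459, 348, 13458, 134, 1345, 245, 123458, 234586, 3459, 1459, 35698, 15698, 1249],
   [1369, 1389, 1389, 1369, 1239, 148, 348, 145, 128, 345, 135, 357, 13457, 245, 12485, 457, 3457],
   [124857, 13458, 3458, 1248, 1458, 1348, 149, 129, 189, 179, 13497, 247, 12497, 237, 123974],
   [123978, 1489, 1249, 159, 1459, 469, 479, 45697, 489, 45698, 467, 348, 34687, 346897, 4679, 134],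
   [349, 1349, 348, 1348, 146, 1346, 346, 1346, 359, 3459, 369, 3469, 468, 389, 3689, 489, 4689],
   [268, 234869, 126, 124, 235, 245, 12345, 124659, 123659, 1246, 123689, 3468, 145, 345, 135, 359],
   [1359, 357, 13457, 578, 457, 3457, 157, 1578, 257, 2578, 137, 147, 13475, 1347, 167, 135786],
   [127, 126, 235, 123, 245, 234, 1234, 146, 12465, 147, 12475, 348, 246, 1246, 479, 489, 346897],
   [4789, 124769, 123748, 2345, 1237, 123758, 1267, 147, 348, 13478, 134786, 234, 349, 2349, 246],
   [2346, 124, 1234, 369, 3469, 123469, 235, 245, 237, 247, 23475, 2347, 267, 23678, 268, 2678],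
   [247, 348, 234785, 234786, 346, 348, 467, 345876, 468, 4678, 349, 126, 146, 12465, 369, 389],
   [35698, 379, 35697, 346978, 389, 3689, 134698, 146, 369, 389, 35698, 379, 35697, 346978, 13469],
   [124678, 479, 3479, 489, 3489, 124789, 3468, 369, 3469, 146, 1346, 349, 3469, 126, 123649, 389],
   [3689, 123689, 2345, 245, 23457, 348, 234587, 234586, 35678, 348, 13458, 346, 13456, 468, 369],
   [3469, 489, 4689, 359, 3569, 125, 389, 3689, 268, 234869, 235, 1235, 126, 123659, 123689],
   [123569, 3468, 1345, 135, 1345, 348, 457, 467, 34687, 345876, 134587, 134586, 346, 3467, 348],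
   [3478, 468, 478, 458, 589, 4589, 569, 35689, 345869, 45687, 34678, 3468, 3567, 3568, 3678, 268],
   [2368, 138, 128, 137, 123, 136, 127, 126, 124, 125, 358, 356, 578, 3578, 158, 357, 156, 157],
   [367, 13567, 567, 3567, 167, 134, 135, 145, 346, 13456, 146, 347, 13457, 457, 467, 14567],
   [134567, 3457, 1456, 457, 234, 12354, 348, 346, 467, 34567, 345876, 123546, 123548, 1457, 145],
   [1345, 456, 458, 347, 34576, 147, 478, 14578, 34578, 14576, 1458, 1456, 347, 348, 456, 34576],
   [345867, 1348, 1347, 13576, 1578, 1356, 3578, 1358, 3568, 135, 348, 345, 347, 468, 3468, 234],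
   [2348, 346, 148, 146, 367, 13467, 467, 3467, 236, 246, 256, 12356, 23465, 2346, 246, 23468],
   [234687, 1468, 1348, 3468, 3478, 3458, 134, 236, 167, 246, 12346, 256, 12356, 346, 2346, 234],
   [356, 2356, 235, 147, 146, 157, 156, 245, 12345, 345, 2345, 458, 468, 14568, 478, 14578, 567],
   [457, 467, 14567, 4567, 4578, 345687, 468, 568, 478, 14678, 578, 15678, 467, 457, 14567, 145678],
   [4678, 4568, 234658, 12365, 12375, 12364, 12374, 2356, 2346, 12376, 237, 267, 12367, 2367, 379],
   [389, 178, 13789, 147, 349, 13479, 148, 134897, 234, 12384, 123849, 347, 1347, 234, 12374, 148],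
   [1478, 123847, 3789, 349, 489, 389, 148, 13489, 178, 134897, 123879, 3489, 3489, 359, 389, 158],
   [13589, 178, 135897, 123879, 3589, 347, 147, 478, 3478, 479, 3479, 234, 2347, 146, 367, 13467],
   [267, 2367, 246, 123467, 346, 247, 2467, 167, 468, 3468, 469, 3469, 489, 678, 168, 178, 689],
   [789, 679, 16789, 6789, 4789, 4689, 1678, 1678, 246798, 234789, 13476, 3467, 467, 367, 145, 156],
   [1456, 357, 13457, 235, 12365, 123657, 345, 1345, 156, 357, 13567, 3457, 123645, 3467, 1467],
   [1347, 247, 2347, 148, 489, 149, 145, 146, 147, 246, 256, 12456, 346, 245, 356, 13456, 235],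
   [12345, 123456, 2456, 2346, 346, 367, 3467, 467, 3467, 468, 3468, 168, 469, 3469, 479, 679, 689],
   [178, 16789, 146897, 4689, 4679, 234679, 13486, 458, 158, 459, 14589, 4589, 1458, 589, 156, 157],
   [158, 459, 14589, 168, 469, 14689, 569, 15689, 689, 568, 5689, 356, 256, 345, 3456, 234659],
   [245698, 345698, 4689, 469, 145896, 124869, 578, 1578, 235, 12385, 178, 1578, 357, 134875],
   [123857, 235, 12375, 167, 1567, 356, 134765, 123756, 356, 1356, 345, 13465, 235, 12365, 245],
   [12465, 468, 134658, 234568, 4589, 179, 234, 12374, 157, 1457, 345, 479, 178, 578, 459, 3459],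
   [45798, 1578, 1478, 1479, 123745, 1479, 469, 168, 14689, 1468, 1469, 158, 459, 14589, 1459],
   [1458, 1489, 479, 789, 4789, 478, 178, 145, 146, 147, 156, 157, 459, 14579, 158, 458, 14578],
   [579, 589, 15789, 145789, 4579, 1578, 235, 12375, 167, 1567, 356, 346, 13476, 134765, 123756],
   [456, 1456, 235, 12365, 245, 12465, 246, 2456, 459, 469, 568, 45698, 145698, 234689, 234589],
   [234, 12374, 157, 1457, 467, 1467, 167, 1467, 346, 235, 12375, 356, 13456, 123756, 123746, 246],
   [1246, 156, 1456, 168, 469, 568, 235, 12365, 459, 45698, 245, 123654, 234589, 1568, 234689],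
   [1468, 345, 1345, 245, 1245, 234, 12354, 158, 458, 235, 2345, 459, 357, 123547, 589, 4589, 257],
   [2357, 578, 45798, 579, 5789, 235789, 234589, 1458, 1458, 1478, 4789, 234789, 234, 12384, 178],
   [147, 1478, 145, 157, 1457, 457, 1457, 158, 1458, 235, 12375, 245, 123754, 124857, 345, 1345],
   [158, 157, 457, 14587, 1457, 123745, 123845, 123847, 1348, 1358, 258, 245, 1245, 256, 157, 257],
   [156, 458, 456, 167, 147, 478, 14578, 267, 12567, 247, 24576, 24578, 14576, 12576, 2456, 2458],
   [1256, 1257, 1257, 1256, 1258, 247, 234, 1234, 146, 148, 248, 246, 267, 12467, 348, 346, 237],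
   [23476, 234786, 2346, 2348, 1246, 1248, 1248, 1246, 1247, 1268, 1278, 1368, 1238, 1378, 1238],
   [178, 1378, 168, 1368, 148, 348, 478, 1478, 134, 1348, 146, 147, 136, 347, 137, 346, 367, 13467],
   [467, 3467, 123, 127, 126, 124, 128, 246, 12486, 124867, 1248, 247, 267, 12467, 237, 23476],
   [23478, 1247, 1236, 1237, 124, 1234, 237, 247, 248, 267, 126, 12467, 12468, 23476, 1248, 1247],
   [1237, 3468, 13478, 3478, 13468, 1478, 1468, 1348, 158, 568, 1568, 135, 1358, 358, 157, 156],
   [458, 456, 356, 357, 137, 136, 167, 147, 478, 14578, 367, 13567, 347, 34576, 34578, 14576],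
   [13576, 13568, 13578, 1357, 3568, 4568, 1458, 1568, 1578, 1358, 389, 789, 689, 248, 468, 2468],
   [246, 348, 247, 478, 2478, 346, 236, 347, 349, 237, 379, 23479, 267, 369, 23469, 367, 23467],
   [467, 3467, 678, 2678, 346978, 23476, 23478, 3489, 3478, 23468, 3468, 2478, 2348, 2468, 258],
   [578, 2578, 358, 458, 257, 457, 359, 237, 349, 379, 23579, 34597, 34598, 23578, 3589, 4578],
   [2578, 2458, 2358, 489, 589, 357, 578, 3578, 345, 347, 134, 145, 135, 13457, 1345, 1345, 135],
   [145, 13457, 1345, 234, 235, 245, 23457, 2345, 2345, 235, 245, 23457, 2345, 346, 356, 568, 3568],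
   [358, 348, 457, 34587, 456, 34586, 567, 569, 579, 367, 35679, 3567, 345879, 345869, 345867],
   [3458, 348, 245, 23458, 145, 13458, 457, 456, 459, 467, 34567, 567, 4567, 367, 479, 34579, 469],
   [34569, 678, 3678, 456978, 34576, 234589, 134586, 134587, 459, 479, 34579, 457, 469, 34569, 467],
   [34567, 567, 4567, 456, 678, 367, 3678, 34576, 456978, 4567, 4579, 149, 349, 189, 145, 359, 125],
   [124, 245, 123458, 129, 249, 2459, 259, 2459, 126, 136, 156, 367, 13567, 369, 13569, 467, 3467],
   [567, 3567, 456, 34576, 569, 3569, 379, 678, 36798, 457, 4567, 579, 345769, 456798, 345967],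
   [1356, 156, 146, 13465, 123648, 123658, 156, 1256, 128, 1268, 269, 456, 1456, 289, 245968, 1289],
   [1269, 1249, 128, 1248, 249, 289, 259, 12459, 239, 2359, 279, 23497, 247, 457, 257, 12457, 2457],
   [245978, 2479, 1289, 1249, 123548, 13459, 1459, 1489, 1349, 159, 1459, 169, 569, 189, 456, 4569],
   [145968, 1689, 1569, 156, 569, 1569, 125, 145, 146, 136, 367, 13467, 467, 3467, 456, 34576, 579],
   [345769, 457, 4567, 124, 245, 123458, 246, 2456, 256, 2456, 245679, 246, 256, 12456, 236, 23465],
   [23467, 1246, 13465, 1456, 123548, 145, 123548, 456, 367, 136, 13567, 146, 13465, 126, 123648],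
   [123658, 34576, 1456, 136, 1356, 126, 123658, 146, 123648, 469, 456, 4569, 569, 127, 167, 367],
   [467, 579, 35679, 457, 34567, 345679, 1467, 1367, 1267, 123, 237, 1237, 267, 247, 23476, 257],
   [23576, 245768, 123678, 124, 1234, 245, 137, 157, 147, 12475, 1347, 1357, 157, 123758, 147],
   [123748, 479, 367, 34679, 345796, 145798, 123458, 4569, 145698, 245, 23456, 236, 2356, 256],
   [2356, 358, 3568, 456, 3456, 145, 13456, 348, 234586, 125, 123548, 123568, 467, 456, 3456, 367],
   [348, 3468, 236, 2346, 246, 2346, 356, 3456, 567, 124, 458, 3458, 245, 123456, 468, 568, 469],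
   [459, 479, 34679, 45697, 45698, 4689, 4568, 234568, 123468, 4567, 3467, 3467, 3457, 457, 348],
   [358, 34587, 3458, 356, 456, 135, 136, 137, 157, 156, 367, 13567, 167, 147, 347, 34576, 478],
   [1478, 458, 34578, 145, 346, 13456, 146, 467, 14567, 134567, 1456, 134578, 14576, 13576, 1356],
   [1357, 1357, 1356, 145, 1345, 235, 257, 236, 237, 256, 267, 367, 23567, 247, 347, 34576, 478],
   [2478, 458, 34578, 245, 246, 346, 23456, 467, 24567, 234567, 2456, 234578, 24576, 23576, 2356],
   [2357, 2356, 2357, 459, 567, 367, 467, 347, 346, 34567, 479, 34579, 469, 45697, 34569, 34576],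
   [4567, 3567, 137, 157, 167, 156, 147, 678, 1678, 479, 14579, 469, 347, 146, 14569, 346, 34569],
   [367, 136, 13567, 358, 134685, 126, 124, 234, 134, 247, 237, 12347, 2347, 2347, 1234, 123645],
   [1246, 123658, 3467, 34579, 456978, 14576, 1567, 13576, 1357, 147, 157, 167, 13576, 14576, 1457],
   [127, 247, 1247, 234, 124, 347, 2347, 134, 367, 34576, 167, 1367, 236, 126, 256, 136, 246],
   [12346, 156, 146, 469, 14569, 24569, 12364, 1256, 1236, 2356, 1267, 123768, 1234, 1247, 123748],
   [157, 358, 167, 14576, 135786, 123758, 167, 1567, 237, 257, 267, 678, 2678, 247, 479, 24579],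
   [579, 4579, 569, 5679, 156798, 24576, 23576, 2357, 156, 129, 279, 179, 379, 479, 359, 349, 347],
   [34579, 369, 136, 13569, 367, 34576, 13567, 34596, 34597, 3579, 1479, 2379, 1279, 1279, 136],
   [367, 13567, 347, 34576, 267, 2367, 247, 2347, 479, 124, 123, 126, 169, 1269, 569, 1569, 134],
   [125, 146, 467, 1467, 469, 1469, 678, 46798, 579, 456798, 156798, 246, 1246, 234, 12364, 236],
   [2346, 358, 256, 234675, 235689, 123548, 256, 236, 246, 12346, 234, 469, 146, 1469, 12364],
   [24569, 2346, 23567, 1256, 146, 467, 1467, 469, 1469, 678, 46798, 579, 456798, 156798, 1346],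
   [1236, 134, 236, 234, 125, 1235, 246, 12346, 256, 469, 146, 14569, 126, 12364, 257, 124675, 358],
   [579, 458, 478, 45789, 345789, 3458, 235789, 123578, 24569, 2356, 1234, 1236, 1234, 125, 1245],
   [134, 123, 1234, 256, 236, 246, 467, 2467, 469, 24569, 569, 4569, 678, 46798, 579, 456798],
   [156798, 12346, 1236, 1256, 123478, 34579, 367, 358, 13568, 678, 3678, 347, 126, 479, 34579],
   [234, 2347, 146, 469, 467, 1467, 4679, 146798, 123645, 123658, 34576, 13567, 136, 1356, 358],
   [135687, 126, 123658, 267, 257, 23576, 2567, 123678, 359, 3459, 349, 3459, 458, 4589, 134598],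
   [3456, 567, 367, 358, 3568, 346, 3456, 467, 146, 136, 156, 14567, 347, 13467, 134675, 1346, 156],
   [136, 13567, 1356, 246, 236, 256, 24567, 347, 23467, 234675, 2346, 256, 236, 23567, 2356, 469],
   [145, 147, 134, 135, 167, 479, 14679, 347, 13457, 34679, 1467, 1345, 1345, 1457, 147, 167, 479],
   [14679, 459, 45697, 568, 456987, 359, 3459, 349, 3459, 456, 4569, 458, 4589, 369, 345968, 468],
   [4568, 236, 234658, 235698, 1467, 135, 134, 137, 157, 347, 1347, 167, 456, 14576, 134576, 1367],
   [1357, 1357, 1345, 136, 1356, 124, 245, 1245, 247, 1247, 123, 235, 1235, 236, 1236, 126, 123658],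
   [125, 234, 347, 2347, 456, 34576, 569, 579, 45679, 679, 5679, 127, 137, 12374, 167, 157, 134756],
   [123758, 123768, 157, 1257, 237, 1237, 137, 1237, 167, 123768, 257, 1257, 568, 156789, 267],
   [235768, 123678, 4569, 123546, 123568, 134, 125, 1235, 347, 1347, 236, 456, 34576, 235, 234576],
   [2356, 123568, 1234, 125, 1245, 236, 134, 12346, 123465, 123568, 149, 1469, 479, 4679, 468],
   [4689, 369, 3469, 169, 1469, 349, 3469, 478, 4789, 136, 236, 159, 1569, 347, 135, 459, 125, 234],
   [145, 1459, 123547, 2346, 12356, 134659, 1356, 134678, 234698, 134698, 4567, 3567, 3567, 3457],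
   [358, 3578, 579, 567, 356, 3567, 569, 156, 167, 157, 15679, 1567, 1567, 157, 167, 15679, 1567],
   [256, 257, 267, 25679, 2567, 2567, 257, 267, 25679, 2567, 456, 457, 467, 45679, 4567, 4567, 457],
   [467, 45679, 4567, 458, 468, 45689, 4568, 478, 468, 45687, 479, 578, 467, 4678, 679, 568, 56789],
   [5678, 4679, 4578, 4789, 678, 578, 568, 679, 56789, 6789, 5678, 5678, 145, 468, 469, 467, 568],
   [459, 578, 679, 56789, 479, 149, 179, 167, 147, 14679, 14678, 1679, 1479, 1459, 4579, 45678],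
   [45698, 4568, 4678, 4689, 135, 125, 259, 279, 239, 12359, 289, 249, 12459, 347, 234975, 234978],
   [2589, 2579, 269, 279, 25697, 289, 568, 25698, 239, 578, 256987, 235978, 235968, 2689, 279, 289],
   [578, 25798, 568, 256987, 249, 245968, 245978, 2789, 359, 379, 239, 2359, 235, 2359, 349, 13459],
   [347, 3479, 245, 345, 3459, 2345, 234578, 3579, 369, 568, 35698, 349, 379, 35697, 578, 356987],
   [345978, 345968, 159, 139, 169, 129, 136, 126, 127, 235, 12365, 367, 123657, 137, 236, 2356],
   [379, 123759, 237, 2357, 267, 2367, 236798, 123758, 1279, 1269, 1369, 1259, 1569, 1359, 459],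
   [1459, 169, 136, 139, 126, 129, 179, 15697, 235, 12365, 123957, 1269, 1269, 1369, 1369, 179],
   [129, 189, 578, 15798, 568, 156987, 125968, 1789, 1279, 379, 578, 35798, 349, 568, 356987],
   [345968, 345978, 469, 479, 45697, 146, 1469, 349, 3469, 346, 3469, 568, 45698, 578, 456987, 347],
   [136, 367, 135678, 3467, 134698, 345798, 479, 147, 1479, 467, 4679, 578, 45798, 349, 3479, 137],
   [167, 1467, 568, 456987, 135768, 134798, 167, 267, 367, 467, 247, 245, 124, 127, 147, 12475],
   [1247, 1247, 123, 234, 1234, 134, 1234, 345, 237, 23475, 349, 234795, 236, 2367, 346, 23476],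
   [246, 2346, 123469, 2345, 126, 146, 124675, 1246, 127, 147, 12475, 1247, 134, 234, 237, 345],
   [23475, 349, 3459, 347, 3457, 136, 146, 12364, 134678, 146, 1346, 134698, 2347, 1234, 345, 237],
   [23475, 349, 234795, 137, 1237, 234, 2347, 147, 123749, 134798, 1345, 2457, 246, 2467, 249],
   [2479, 124, 123, 126, 146, 245, 12465, 124657, 124679, 129, 1269, 236, 1236, 239, 1239, 349],
   [234, 2349, 237, 2347, 234796, 234698, 134, 234, 349, 2349, 347, 2347, 236, 234678, 234698],
   [1234, 1234, 127, 1247, 147, 1247, 124769, 347, 147, 346, 345, 137, 13475, 134765, 3457, 3467],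
   [1467, 3467, 236, 137, 235, 127, 12375, 12376, 2356, 1367, 2367, 127, 247, 147, 245, 12475],
   [2457, 1247, 246798, 1267, 147, 137, 345, 13475, 134756, 136798, 146798, 126, 1256, 124, 1245],
   [236, 12356, 237, 12357, 247, 12457, 246, 12456, 234, 12354, 136, 1236, 267, 134, 1234, 348],
   [234786, 123468, 123678, 136, 1356, 137, 1357, 348, 13458, 346, 13456, 134, 1345, 347, 13457],
   [146, 1346, 367, 123, 237, 1237, 235, 1235, 247, 2347, 124, 245, 123457, 234576, 123478, 125],
   [1235, 236, 123567, 123568, 134678, 146, 1456, 147, 1457, 126, 124, 245, 1245, 247, 1247, 467],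
   [468, 267, 245786, 679, 568, 578, 56789, 456789, 4568, 246789, 124658, 124657, 1246, 128, 1268],
   [127, 125, 245, 1245, 124758, 1257, 136, 135, 236, 346, 1346, 125, 234, 12354, 2346, 12356],
   [1236, 1356, 137, 135, 345, 1345, 134758, 1357, 167, 367, 468, 14678, 236, 346, 246, 347],
   [234675, 3467, 124768, 134768, 123768, 1367, 348, 467, 347, 469, 479, 346, 367, 34679, 3467],
   [3468, 134789, 134689, 3478, 134687, 349, 289, 239, 249, 123, 237, 1237, 129, 279, 267, 367],
   [179, 169, 479, 679, 469, 247, 24679, 347, 34679, 468, 346789, 346, 3467, 234768, 1469, 1679],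
   [1479, 1269, 1279, 2367, 123678, 2379, 1239, 124, 134, 12349, 1234, 125, 1245, 247, 267, 129],
   [149, 469, 479, 24679, 1479, 1469, 1249, 134, 139, 234, 149, 12394, 1349, 1234, 1349, 135, 1345],
   [236, 367, 123567, 347, 134576, 134578, 123568, 124576, 124578, 2349, 269, 279, 236, 2369, 367],
   [23697, 237, 2379, 267, 2367, 123678, 123798, 123698, 189, 1289, 239, 2389, 149, 1489, 234],
   [2349, 134, 1349, 135, 1345, 347, 367, 125, 123548, 236, 123567, 123568, 134576, 134578, 379],
   [347, 3479, 135, 359, 134598, 578, 35798, 345978, 134578, 134798, 5679, 367, 3567, 679, 468],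
   [478, 46789, 467, 456, 457, 569, 45679, 458, 456897, 4568, 4567, 4567, 4678, 568, 578, 56789],
   [5678, 257, 256, 279, 578, 2578, 259, 237, 235, 236, 239, 289, 126, 136, 269, 12369, 267, 12367],
   [569, 2569, 678, 26798, 256798, 1236, 136, 267, 156, 12365, 678, 2678, 569, 25679, 167, 1567],
   [157, 1567, 356, 1356, 369, 3569, 359, 3569, 137, 135768, 379, 356978, 136798, 12367, 156, 267],
   [678, 2678, 478, 4678, 146, 245, 12465, 123654, 347, 134675, 134678, 12567, 135678, 2789, 2379],
   [2356, 2357, 2357, 2579, 2579, 2567, 267, 2567, 157, 578, 1578, 156, 127, 159, 135, 179, 137],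
   [125, 126, 136, 129, 139, 123, 124, 134, 145, 147, 458, 1458, 478, 1478, 236, 246, 12346, 256],
   [12356, 345, 235, 245, 12345, 2345, 2356, 234658, 256, 235, 2356, 246, 12456, 245, 2456, 347],
   [234675, 234578, 235678, 1457, 457, 234, 12354, 456, 459, 479, 147, 14579, 167, 14576, 346, 356],
   [13576, 134765, 123746, 4579, 1459, 1456, 1457, 145, 345, 349, 146, 346, 356, 13456, 359, 13459],
   [456, 3456, 369, 13469, 345968, 1346, 1346, 1349, 1345, 1345, 247, 145, 234, 1234, 146, 249],
   [246, 347, 457, 2457, 259, 12459, 346, 269, 12469, 239, 23496, 279, 234975, 289, 245978, 2489],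
   [2346, 2347, 1246, 1249, 1246, 1245, 1247, 239, 279, 12379, 289, 259, 12359, 235978, 2389, 1239],
   [1359, 1279, 1356, 1256, 1257, 1357, 1579, 1357, 1579, 1257, 1567, 167, 1567, 467, 147, 1467],
   [146, 1467, 347, 3467, 478, 4678, 246, 2467, 247, 2467, 136, 126, 234, 12364, 236, 2346, 234678],
   [124678, 134678, 279, 289, 269, 259, 249, 126, 156, 12569, 146, 12469, 125, 124, 145, 12459],
   [245, 1245, 458, 478, 45789, 145687, 124658, 1246, 1256, 127, 1267, 123, 237, 1237, 136, 1236],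
   [123678, 124, 134, 149, 129, 239, 12349, 1239, 1249, 1249, 1234, 125, 145, 12459, 1245, 135],
   [237, 12357, 235, 379, 136, 156, 12365, 236, 356, 1356, 578, 256, 359, 369, 23569, 3569, 35798],
   [12356, 125678, 1236, 123678, 2379, 1235, 237, 236, 356, 136, 12367, 256, 156, 123675, 578, 678],
   [569, 369, 359, 23569, 3569, 3569, 56798, 5678, 135678, 2356, 123576, 2367, 123578, 478, 24798],
   [479, 247, 2479, 246, 2469, 126, 156, 12569, 146, 124695, 124698, 146, 1246, 124678, 2479, 578],
   [25798, 239, 256, 2569, 236, 359, 2359, 356, 2356, 369, 235698, 137, 135768, 379, 678, 36798],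
   [356978, 135798, 235678, 235978, 678, 26798, 239, 259, 249, 578, 5678, 346, 23496, 356, 23596],
   [569, 2569, 457, 345679, 345678, 246978, 256978, 236978, 2789, 259, 2579, 269, 2679, 239, 369],
   [2369, 289, 678, 356, 569, 3569, 56798, 235968, 236978, 2389, 249, 469, 2469, 289, 678, 456],
   [569, 4569, 56798, 245968, 246978, 2489, 478, 479, 678, 458, 45789, 469, 569, 246, 2469, 256],
   [2569, 245687, 56798, 46798, 4678, 4789, 179, 129, 127, 126, 136, 137, 235, 12375, 236, 12376],
   [256, 123765, 356, 578, 156, 678, 569, 369, 359, 13569, 3569, 3569, 56798, 5678, 1356, 235678],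
   [123756, 236, 235, 379, 369, 2369, 359, 2359, 678, 36798, 356978, 1379, 123758, 123768, 236],
   [1236, 137, 1367, 123768, 1269, 1279, 1279, 169, 1679, 159, 1579, 569, 256, 2569, 156, 1569],
   [137, 379, 1379, 135, 136, 359, 3579, 369, 3679, 356, 1356, 236, 235, 127, 12376, 126, 12365],
   [237, 12367, 1237, 2356, 235698, 1367, 1357, 147, 146, 145, 134, 1347, 347, 136, 345, 13465],
   [1345, 134675, 1347, 1457, 1467, 136, 135, 356, 1356, 369, 1369, 359, 1359, 236, 235, 126],
   [12365, 578, 458, 4578, 379, 35798, 457, 4578, 349, 347, 479, 3479, 459, 4579, 456, 4569],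
   [345968, 3479, 134798, 125678, 2356, 235698, 1356, 578, 123, 237, 1237, 236, 1236, 126, 235],
   [359, 2359, 369, 379, 35798, 356987, 235698, 123658, 123678, 126, 1236, 237, 236, 379, 2379],
   [369, 2369, 349, 146, 13469, 134697, 134798, 2367, 123678, 135678, 678, 56798, 457, 456798, 578],
   [5678, 458, 4578, 135, 359, 1359, 369, 3569, 379, 356978, 237, 236, 125, 356, 256, 12356, 2356],
   [235768, 12357, 2367, 235798, 137, 1357, 123, 237, 1237, 235, 1235, 125, 127, 123758, 124, 147],
   [1247, 126, 134, 347, 1347, 145, 1345, 134578, 136, 369, 1369, 346, 379, 359, 469, 3469, 349],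
   [456, 34596, 459, 4569, 479, 456978, 146798, 346978, 356978, 136798, 1346, 236, 1236, 256],
   [123567, 235678, 156, 1256, 125678, 145, 234, 1234, 134, 1234, 348, 13458, 347, 13457, 247],
   [2347, 123478, 1245, 123578, 125, 1235, 237, 235, 379, 2379, 359, 2359, 135798, 2357, 123578],
   [5679, 359, 3579, 379, 3579, 578, 5789, 135, 137, 136, 134, 235, 234, 236, 123, 124, 126, 125],
   [246, 12346, 245, 12345, 146, 145, 256, 12356, 345, 2345, 468, 1468, 458, 1458, 234658, 12354],
   [12364, 1235, 1236, 1234, 128, 1238, 237, 129, 289, 139, 239, 179, 157, 127, 147, 279, 12379],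
   [478, 1478, 259, 125, 12359, 145, 12354, 345, 1345, 457, 347, 3457, 249, 24597, 234978, 1457],
   [235978, 12374, 12375, 1579, 12397, 1239, 1239, 1289, 125, 257, 12357, 159, 1259, 145, 459],
   [1459, 479, 4579, 247, 347, 345, 23475, 457, 2457, 3457, 345798, 245798, 12354, 256, 257, 145],
   [12354, 345, 1345, 124, 245, 1245, 247, 12347, 246, 12346, 457, 456, 267, 24576, 467, 126, 156],
   [146, 14567, 12364, 12365, 12367, 24567, 2456, 2457, 247, 245, 246, 458, 2458, 468, 2468, 126],
   [267, 12367, 146, 456, 24576, 1456, 1246, 146, 12364, 156, 12365, 134658, 12346, 12345, 12347],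
   [12357, 12356, 1237, 256, 2356, 356, 2356, 126, 156, 568, 1568, 369, 367, 569, 135679, 3569],
   [235678, 235698, 12365, 1236, 124, 245, 12345, 2345, 1234, 237, 2357, 257, 2357, 235798, 145],
   [345, 347, 146, 346, 356, 13456, 156, 456, 3456, 367, 13467, 568, 1568, 345768, 13465, 1346],
   [1346, 1347, 1345, 1345, 356, 1356, 156, 1356, 367, 569, 35679, 568, 35678, 369, 3569, 135698],
   [1367, 157, 1357, 135798, 157, 1357, 137, 1357, 135798, 579, 5789, 568, 5689, 358, 569, 5689],
   [259, 2589, 459, 359, 159, 1589, 458, 457, 179, 1579, 456, 269, 2569, 349, 379, 137, 1379, 369],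
   [236, 2369, 157, 13578, 167, 135786, 127, 123768, 125789, 34596, 34597, 34598, 4568, 4579, 4589],
   [3589, 4589, 3589, 469, 4689, 478, 4789, 149, 1489, 479, 4789, 349, 189, 1489, 348, 169, 1469],
   [346, 347, 179, 1479, 159, 1589, 127, 126, 124, 125, 345, 137, 379, 1379, 147, 157, 578, 1578],
   [135, 145, 359, 1359, 357, 13457, 457, 3457, 345978, 1345, 235, 1235, 357, 136, 156, 367, 13567],
   [369, 1369, 356, 568, 1568, 567, 3567, 456, 34576, 359, 345967, 345968, 1356, 1356, 146, 13468],
   [467, 369, 34697, 145, 358, 457, 34587, 345876, 13458, 457, 245, 1245, 356, 34567, 359, 34597],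
   [456, 3456, 234596, 1457, 1467, 1357, 13475, 1347, 147, 13478, 167, 134786, 246, 236, 146, 256],
   [136, 135, 12356, 156, 157, 12576, 145, 12456, 235, 1235, 456, 358, 34586, 123758, 1456, 13465],
   [1236, 23465, 1246, 123768, 124769, 456, 358, 34586, 3458, 3456, 245, 1245, 256, 145, 1245, 459],
   [257, 156, 456, 247, 267, 12567, 24576, 24579, 2456, 1256, 1257, 124589, 1256, 247, 146, 267],
   [12467, 237, 23476, 23478, 1246, 1247, 167, 146, 679, 1679, 678, 1678, 136, 367, 13467, 369],
   [13469, 379, 3679, 467, 3467, 346978, 13468, 124689, 1267, 147, 137, 124, 1247, 167, 246, 12476],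
   [126, 1267, 146, 1246, 124689, 13476, 13478, 124789, 3478, 3469, 3489, 3489, 3689, 3789, 369],
   [3689, 239, 2389, 139, 1389, 189, 1389, 289, 2389, 379, 3789, 269, 2369, 169, 1369, 279, 2379],
   [179, 1379, 149, 1489, 159, 1589, 249, 234, 2349, 349, 248, 234897, 2489, 2349, 358, 135, 1358],
   [356, 578, 3578, 568, 3568, 357, 235, 2358, 127, 136, 156, 367, 13567, 567, 3567, 137, 157, 167],
   [134, 348, 1348, 145, 1345, 458, 456, 347, 34576, 147, 478, 1478, 34578, 14576, 1456, 3458, 347],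
   [346, 456, 34576, 345, 348, 345867, 3458, 3456, 1346, 1347, 13576, 1357, 157, 13578, 359],
   [135798, 123759, 1356, 126, 236, 1236, 156, 13568, 256, 1256, 359, 235698, 123659, 123689, 137],
   [123, 1237, 157, 167, 236, 12376, 125, 1235, 256, 12576, 359, 235698, 123569, 13576, 1357],
   [123789, 3578, 3568, 359, 3589, 258, 2358, 248, 468, 2468, 246, 348, 247, 245, 478, 2478, 346],
   [236, 347, 345, 235, 237, 257, 356, 23456, 357, 23457, 456, 3456, 367, 23467, 256, 578, 2578],
   [568, 2568, 345768, 23465, 23475, 23478, 23458, 3458, 3478, 23468, 3468, 2458, 2478, 2348, 2468],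
   [137, 147, 479, 1479, 478, 1478, 127, 157, 578, 1578, 579, 1579, 167, 678, 1678, 136, 146, 468],
   [1468, 469, 1469, 126, 156, 569, 1569, 267, 237, 12367, 257, 12567, 247, 12467, 459, 245796],
   [348, 234786, 489, 245798, 234789, 256, 567, 2567, 257, 124, 123, 125, 135, 237, 12357, 236],
   [12356, 357, 367, 13567, 123567, 2357, 237, 356, 23576, 123576, 123578, 135, 1235, 123589, 134],
   [236, 237, 247, 12347, 246, 12346, 346, 2346, 234768, 1237, 1236, 1234, 247, 456, 24576, 467],
   [2467, 145, 458, 4568, 457, 4567, 589, 456798, 125, 12457, 489, 4589, 348, 345879, 135, 234],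
   [12354, 349, 3489, 123, 1235, 134, 1234, 123489, 123589, 1456, 1247, 125, 589, 256798, 237, 236],
   [235, 135, 12356, 1235, 2357, 2367, 235789, 1257, 257, 2567, 589, 256798, 237, 236, 356, 2356],
   [235769, 235689, 235789, 145, 356, 1356, 345, 13465, 235, 12365, 245, 12465, 458, 1458, 346],
   [3456, 234568, 1456, 234, 12364, 236, 123, 1236, 124, 1246, 134, 1234, 349, 345, 489, 3489, 459],
   [3459, 156, 125, 1256, 245, 12465, 145, 1245, 124589, 13465, 3459, 123489, 1236, 467, 346, 1346],
   [134, 349, 3469, 348, 3468, 125, 123, 126, 124, 246, 1246, 234, 12364, 236, 2346, 135, 145, 156],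
   [1456, 458, 1458, 459, 1459, 356, 1356, 235, 12365, 245, 123654, 489, 468, 469, 568, 456987],
   [4568, 234569, 234568, 234589, 345, 1345, 245, 1245, 356, 123546, 156, 256, 2356, 569, 1569],
   [568, 1568, 589, 237, 267, 12367, 2367, 247, 257, 123574, 2457, 257, 458, 24578, 234758, 267],
   [235768, 256798, 235689, 123645, 145, 1345, 123549, 1234, 1236, 234, 135, 235, 237, 145, 126],
   [12364, 257, 12357, 357, 2357, 156, 12365, 267, 456, 1456, 458, 1458, 569, 25679, 568, 25678],
   [367, 135679, 347, 345768, 589, 356798, 345789, 12367, 12354, 1237, 1235, 1235, 1234, 257, 135],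
   [235, 237, 123, 1235, 236, 234, 256, 126, 12364, 145, 12354, 267, 457, 246, 24567, 456, 124],
   [247, 12347, 24576, 12346, 2456, 1457, 1267, 12356, 1234, 1236, 2357, 1235, 123589, 1257, 1346],
   [1467, 126, 367, 236, 1236, 123, 124, 246, 348, 23468, 134, 146, 1346, 1246, 123468, 247, 467],
   [267, 237, 146, 12467, 134, 12347, 234, 1234, 349, 348, 468, 3468, 134698, 123648, 123649],
   [123678, 2467, 2467, 134, 349, 1349, 348, 1348, 146, 1346, 234, 347, 2347, 468, 34678, 469],
   [34679, 267, 124678, 489, 246798, 234689, 123649, 347, 234, 1234, 237, 2347, 267, 123678, 349],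
   [234798, 146, 348, 13468, 469, 1469, 489, 246798, 234689, 123649, 1347, 234, 1234, 146, 134],
   [1234, 349, 13469, 123489, 1246, 1236, 1367, 123689, 346, 13476, 467, 1467, 567, 1567, 356],
   [13576, 456, 14576, 457, 4567, 569, 5679, 345679, 235, 12375, 357, 1357, 145, 345, 13475, 245],
   [12475, 347, 3457, 458, 1458, 234578, 1457, 234, 12374, 123, 1237, 124, 1247, 134, 1234, 349],
   [346, 167, 468, 3468, 246, 12476, 236, 12376, 234698, 13476, 3469, 123489, 347, 1347, 134, 348],
   [3478, 135, 124, 247, 1247, 136, 125, 123, 127, 126, 234, 12374, 145, 157, 1457, 458, 1458, 459],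
   [1459, 235, 12375, 357, 1357, 245, 123754, 478, 479, 489, 578, 45798, 4578, 234589, 124759],
   [234578, 345, 1345, 357, 123547, 157, 578, 1578, 146, 167, 1467, 356, 13576, 346, 134765],
   [123746, 246, 1246, 156, 346, 1346, 367, 123647, 236, 2346, 568, 1568, 356, 123546, 256, 2356],
   [235678, 123645, 123745, 1236, 1237, 236, 234, 235, 237, 246, 12346, 256, 12356, 145, 245],
   [12345, 257, 12357, 457, 1457, 458, 1458, 459, 1459, 345, 2345, 479, 478, 578, 468, 567, 45687],
   [489, 45798, 469, 678, 46798, 456978, 234659, 234658, 4578, 234758, 234759, 12354, 1237, 1235],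
   [1234, 1236, 245, 1245, 145, 1245, 123, 1235, 235, 234, 236, 237, 127, 12374, 256, 167, 12376],
   [246, 12346, 257, 157, 123754, 456, 569, 2569, 267, 24576, 579, 2579, 356, 23576, 135769, 2456],
   [123574, 12356, 1237, 1236, 2345, 1235, 126, 146, 1346, 234, 167, 127, 12374, 1267, 1367],
   [123648, 123689, 127, 1247, 123, 1234, 237, 235, 247, 245, 157, 12375, 479, 2479, 459, 2459],
   [345, 489, 578, 257, 2578, 23475, 145798, 124789, 134759, 12345, 12347, 1235, 1237, 157, 145],
   [1345, 125, 234, 127, 12374, 1257, 123548, 123589, 1357, 1347, 127, 123, 237, 1237, 124, 125],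
   [126, 348, 147, 13478, 234, 123748, 478, 3478, 349, 134798, 123749, 349, 3489, 157, 135, 1357],
   [235, 1235, 134, 147, 1347, 136, 167, 1367, 236, 256, 12576, 123765, 123769, 236, 1236, 156],
   [346, 1346, 167, 356, 134765, 1356, 123769, 123658, 234, 1234, 145, 147, 345, 13475, 1345],
   [123749, 123549, 235, 135, 134, 147, 1347, 245, 12345, 234, 145, 458, 1458, 459, 1459, 478, 479],
   [579, 578, 589, 489, 45798, 136, 156, 167, 1367, 567, 1567, 569, 1569, 678, 56798, 5678, 12365],
   [146, 1346, 469, 567, 45697, 678, 46798, 456978, 134689, 45789, 4578, 4579, 124759, 124758],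
   [12354, 123749, 145, 345, 234, 1234, 245, 147, 12475, 123749, 2345, 1345, 1345, 1235, 123759],
   [136, 236, 1236, 1236, 123689, 135, 1235, 123589, 247, 234, 1234, 134, 1234, 349, 23479, 123489],
   [1247, 1237, 123789]]

lemma run_certificate : run certificate [0] = true := by
  decide +kernel

lemma not_crossingFree (hq : IsSorted q) : ¬CrossingFree q := fun hfree => by
  have h : Holds q 0 := fun a b c _ _ _ => by simp
  have := run_eq_false hq hfree certificate [0] ⟨0, by simp, h⟩
  rw [run_certificate] at this
  exact Bool.false_ne_true this.symm

end SignCertificate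

/-- Every set of at least 10 points in the plane in general position contains a
3-crossing family. -/
theorem every_10_points_contains_3_crossing_family
    (S : Finset (ℝ × ℝ)) (hcard : 10 ≤ S.card) (hgp : GenPos S) :
    HasCrossingFamily S 3 := by
  obtain ⟨q, hmem, hq⟩ := exists_isSorted hcard hgp
  have hfree := SignCertificate.not_crossingFree hq
  simp only [SignCertificate.CrossingFree, not_forall] at hfree
  obtain ⟨a, b, c, x, y, z, hab, hbc, hax, hby, hcz, hx, hy, hz, h₁, h₂, h₃, -⟩ := hfree
  have nab := hq.ne hab (by omega)
  have nac := hq.ne (hab.trans hbc) (by omega)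
  have nbc := hq.ne hbc (by omega)
  refine ⟨{(q a, q x), (q b, q y), (q c, q z)}, ⟨?_, ?_⟩, ?_⟩
  · simp only [Finset.mem_insert, Finset.mem_singleton]
    rintro e (rfl | rfl | rfl)
    · exact ⟨hmem a (by omega), hmem x hx, hq.ne hax hx⟩
    · exact ⟨hmem b (by omega), hmem y hy, hq.ne hby hy⟩
    · exact ⟨hmem c (by omega), hmem z hz, hq.ne hcz hz⟩
  · simp only [Finset.mem_insert, Finset.mem_singleton]
    rintro e (rfl | rfl | rfl) f (rfl | rfl | rfl) hef
    exacts [absurd rfl hef, h₁, h₂, h₁.symm, absurd rfl hef, h₃, h₂.symm, h₃.symm, absurd rfl hef]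
  · exact Finset.card_eq_three.2 ⟨_, _, _, fun h => nab (congrArg Prod.fst h),
      fun h => nac (congrArg Prod.fst h), fun h => nbc (congrArg Prod.fst h), rfl⟩
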